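/- arXiv:math/9909009 — 2 statements merged into one kernel-verified Lean document; each statement's English description precedes it below -/
import Mathlib

section
/- Let 𝔽_q be a finite field and f ∈ 𝔽_q[x_1,…,x_n]. The following are equivalent: (i) the partial derivatives ∂f/∂x_1, …, ∂f/∂x_n have only finitely many common zeros in an algebraic closure of 𝔽_q (i.e. f : 𝔸^n → 𝔸^1 has only isolated critical points); (ii) H^i(Ω^·, φ_f) = 0 for all i ≠ n, where φ_f(ω) = df ∧ ω. Moreover, either condition implies that dim_{𝔽_q} H^n(Ω^·, φ_f) = dim_{𝔽_q} 𝔽_q[x_1,…,x_n]/(∂f/∂x_1,…,∂f/∂x_n) is finite. -/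
set_option synthInstance.maxHeartbeats 1000000
set_option maxHeartbeats 1000000
open MvPolynomial

/-- The polynomial ring `𝔽_q[x_1,…,x_n]`. -/
abbrev PolyRing (F : Type) [Field F] (n : ℕ) : Type := MvPolynomial (Fin n) F

/-- The exterior algebra over `R = F[x_1,…,x_n]` of the free module on `dx_1,…,dx_n`;
the module of differential `k`-forms `Ω^k` is its degree-`k` part. -/
abbrev FormAlgebra (F : Type) [Field F] (n : ℕ) : Type :=
  ExteriorAlgebra (PolyRing F n) (Fin n → PolyRing F n)

/-- `dg = Σ_i (∂g/∂x_i) dx_i` as an element of the exterior algebra. -/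
noncomputable def dform {F : Type} [Field F] {n : ℕ} (g : PolyRing F n) : FormAlgebra F n :=
  ExteriorAlgebra.ι (PolyRing F n) (fun j => MvPolynomial.pderiv j g)

/-- `c · dx_{s 0} ∧ ⋯ ∧ dx_{s (k-1)}`. -/
noncomputable def wedgeMonomial {F : Type} [Field F] {n : ℕ} (k : ℕ) (s : Fin k → Fin n)
    (c : PolyRing F n) : FormAlgebra F n :=
  c • (List.ofFn fun i => ExteriorAlgebra.ι (PolyRing F n)
        (Pi.single (s i) (1 : PolyRing F n))).prod

/-- `ω` is a differential `k`-form, i.e. an `R`-linear combination of `k`-fold wedge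
products of the `dx_i`. -/
def IsForm {F : Type} [Field F] {n : ℕ} (k : ℕ) (ω : FormAlgebra F n) : Prop :=
  ω ∈ AddSubgroup.closure {x | ∃ (s : Fin k → Fin n) (c : PolyRing F n), x = wedgeMonomial k s c}

/-- `ω` is a homogeneous `k`-form whose coefficients are homogeneous polynomials of degree `d`. -/
def IsHomogeneousForm {F : Type} [Field F] {n : ℕ} (k d : ℕ) (ω : FormAlgebra F n) : Prop :=
  ω ∈ AddSubgroup.closure {x | ∃ (s : Fin k → Fin n) (c : PolyRing F n),
    c.IsHomogeneous d ∧ x = wedgeMonomial k s c}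

/-- The system of homogeneous equations `g i = 0` defines a smooth complete intersection
in `P^{n-1}`: over an algebraic closure, the only common zero of the `g i` in affine
`n`-space at which the differentials `d(g i)` are linearly dependent is the origin. -/
def IsSmoothCI {F : Type} [Field F] {n : ℕ} {ι : Type} (g : ι → PolyRing F n) : Prop :=
  ∀ x : Fin n → AlgebraicClosure F,
    (∀ i, MvPolynomial.eval x
      (MvPolynomial.map (algebraMap F (AlgebraicClosure F)) (g i)) = 0) →
    ¬ LinearIndependent (AlgebraicClosure F)
      (fun i => fun j : Fin n => MvPolynomial.eval x
        (MvPolynomial.map (algebraMap F (AlgebraicClosure F)) (MvPolynomial.pderiv j (g i)))) →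
    x = 0

/-- `df_{i_1} ∧ ⋯ ∧ df_{i_l}` for the increasing enumeration `i_1 < ⋯ < i_l` of `s`. -/
noncomputable def dWedge {F : Type} [Field F] {n : ℕ} {r : ℕ} (g : Fin r → PolyRing F n)
    (s : Finset (Fin r)) : FormAlgebra F n :=
  ((s.sort (· ≤ ·)).map fun i => dform (g i)).prod

/-- The polynomial form `(Σ_i a_i (∏_j f_j^{expo j}) df_i/f_i) ∧ Ω_{i_1⋯i_l}`, where
`Ω_{i_1⋯i_l} = (df_{i_1}/f_{i_1}) ∧ ⋯ ∧ (df_{i_l}/f_{i_l})` and `s = {i_1 < ⋯ < i_l}`;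
all denominators cancel provided `expo j ≥ 1` for all `j`. -/
noncomputable def clearedThetaOmega {F : Type} [Field F] {n : ℕ} {r : ℕ}
    (g : Fin r → PolyRing F n) (a : Fin r → ℕ) (expo : Fin r → ℕ) (s : Finset (Fin r)) :
    FormAlgebra F n :=
  ∑ i ∈ sᶜ, ((a i : PolyRing F n) *
      ∏ j, g j ^ (expo j - (if j ∈ insert i s then 1 else 0))) • (dform (g i) * dWedge g s)

/-- The exterior algebra of forms as an `F`-vector space (restriction of scalars along
`F → F[x_1,…,x_n]`). -/
noncomputable instance formAlgebraModule (F : Type) [Field F] (n : ℕ) :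
    Module F (FormAlgebra F n) :=
  Module.compHom _ (algebraMap F (PolyRing F n))

/-- `Ω^k` as an `F`-subspace of the exterior algebra. -/
noncomputable def formSubspace (F : Type) [Field F] (n : ℕ) (k : ℕ) :
    Submodule F (FormAlgebra F n) :=
  Submodule.span F {x | IsForm k x}

/-- The image `df ∧ Ω^{k-1} ⊆ Ω^k` as an `F`-subspace of the exterior algebra. -/
noncomputable def boundarySubspace (F : Type) [Field F] (n : ℕ) (f : PolyRing F n) (k : ℕ) :
    Submodule F (FormAlgebra F n) :=
  Submodule.span F {x | ∃ η, IsForm (k - 1) η ∧ x = dform f * η}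

/-- The top cohomology group `H^n(Ω^·, φ_f) = Ω^n / (df ∧ Ω^{n-1})` of the complex
`(Ω^·, φ_f)` (note `Ω^{n+1} = 0`, so every `n`-form is a cocycle). -/
abbrev topCohomology (F : Type) [Field F] (n : ℕ) (f : PolyRing F n) : Type :=
  ↥(formSubspace F n n) ⧸
    (boundarySubspace F n f n).comap (formSubspace F n n).subtype

namespace ExteriorAlgebra

section Koszul

variable {R M : Type*} [CommRing R] [AddCommGroup M] [Module R M]

/-- The forms of degree `i - 1`, with the convention that there are none for `i = 0`. -/
noncomputable def prevForms (R M : Type*) [CommRing R] [AddCommGroup M] [Module R M] :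
    ℕ → Submodule R (ExteriorAlgebra R M)
  | 0 => ⊥
  | i + 1 => ⋀[R]^i M

/-- The Koszul cohomology `H^i(v; R ⧸ I)` vanishes for all `i < k`. -/
def KoszulExactBelow (v : M) (I : Ideal R) (k : ℕ) : Prop :=
  ∀ i < k, ∀ ω ∈ ⋀[R]^i M, ι R v * ω ∈ I • (⊤ : Submodule R (ExteriorAlgebra R M)) →
    ∃ η ∈ prevForms R M i, ω - ι R v * η ∈ I • (⊤ : Submodule R (ExteriorAlgebra R M))

theorem koszulExactBelow_zero (v : M) (I : Ideal R) : KoszulExactBelow v I 0 :=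
  fun _ hi => absurd hi (Nat.not_lt_zero _)

theorem ι_mul_ι_mul (v : M) (ω : ExteriorAlgebra R M) : ι R v * (ι R v * ω) = 0 := by
  rw [← mul_assoc, ι_sq_zero, zero_mul]

theorem ι_mul_mem_exteriorPower (v : M) {i : ℕ} {ω : ExteriorAlgebra R M}
    (hω : ω ∈ ⋀[R]^i M) : ι R v * ω ∈ ⋀[R]^(i + 1) M := by
  rw [exteriorPower, pow_succ']
  exact Submodule.mul_mem_mul (LinearMap.mem_range_self _ v) hω

theorem ι_mul_prevForms (v : M) {i : ℕ} {ω : ExteriorAlgebra R M}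
    (hω : ω ∈ prevForms R M i) : ι R v * ω ∈ ⋀[R]^i M := by
  cases i with
  | zero =>
    rw [(Submodule.mem_bot R).1 hω, mul_zero]
    exact zero_mem _
  | succ i => exact ι_mul_mem_exteriorPower v hω

theorem contractLeft_mem_prevForms (d : Module.Dual R M) (i : ℕ) {ω : ExteriorAlgebra R M}
    (hω : ω ∈ ⋀[R]^i M) :
    CliffordAlgebra.contractLeft (Q := 0) d ω ∈ prevForms R M i := by
  induction i generalizing ω with
  | zero =>
    rw [exteriorPower, pow_zero] at hω
    obtain ⟨r, rfl⟩ := Submodule.mem_one.1 hω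
    rw [prevForms, Submodule.mem_bot]
    exact CliffordAlgebra.contractLeft_algebraMap (Q := 0) d r
  | succ i ih =>
    rw [exteriorPower, pow_succ'] at hω
    induction hω using Submodule.mul_induction_on' with
    | mem_mul_mem a ha b hb =>
      obtain ⟨m, rfl⟩ := ha
      have h := CliffordAlgebra.contractLeft_ι_mul (Q := 0) d m b
      change CliffordAlgebra.contractLeft (Q := 0) d (ι R m * b) = _ at h
      rw [h]
      exact sub_mem (Submodule.smul_mem _ _ hb) (ι_mul_prevForms m (ih hb))
    | add x _ y _ hx hy =>
      rw [map_add]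
      exact add_mem hx hy

theorem map_mem_ideal_smul_top {N P : Type*} [AddCommGroup N] [Module R N] [AddCommGroup P]
    [Module R P] (g : N →ₗ[R] P) {I : Ideal R} {ω : N} (hω : ω ∈ I • (⊤ : Submodule R N)) :
    g ω ∈ I • (⊤ : Submodule R P) := by
  have := Submodule.mem_map_of_mem (f := g) hω
  rw [Submodule.map_smul''] at this
  exact Submodule.smul_mono le_rfl le_top this

theorem mem_ideal_smul_top_of_smul_mem {N : Type*} [AddCommGroup N] [Module R N]
    [Module.Free R N] {I : Ideal R} {x : R} (hx : ∀ r, x * r ∈ I → r ∈ I) {ω : N}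
    (hω : x • ω ∈ I • (⊤ : Submodule R N)) : ω ∈ I • (⊤ : Submodule R N) := by
  let b := Module.Free.chooseBasis R N
  rw [← b.linearCombination_repr ω, Finsupp.linearCombination_apply]
  refine Submodule.sum_mem _ fun s _ => Submodule.smul_mem_smul (hx _ ?_) trivial
  have := map_mem_ideal_smul_top (b.coord s) hω
  simpa using this

theorem exists_smul_add_of_mem_sup_smul_top {N : Type*} [AddCommGroup N] [Module R N]
    {I : Ideal R} {x : R} {ω : N} (hω : ω ∈ (I ⊔ Ideal.span {x}) • (⊤ : Submodule R N)) :
    ∃ α, ω - x • α ∈ I • (⊤ : Submodule R N) := by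
  rw [Submodule.sup_smul, Submodule.ideal_span_singleton_smul] at hω
  obtain ⟨β, hβ, γ, ⟨α, -, rfl⟩, rfl⟩ := Submodule.mem_sup.1 hω
  exact ⟨α, by simpa using hβ⟩

theorem smul_mem_sup_smul_top {N : Type*} [AddCommGroup N] [Module R N]
    (I : Ideal R) (x : R) (ω : N) : x • ω ∈ (I ⊔ Ideal.span {x}) • (⊤ : Submodule R N) :=
  Submodule.smul_mem_smul (Ideal.mem_sup_right (Ideal.mem_span_singleton_self x)) trivial

theorem exists_homogeneous_smul_add_of_mem_sup_smul_top {I : Ideal R} {x : R} {i : ℕ}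
    {ω : ExteriorAlgebra R M} (hi : ω ∈ ⋀[R]^i M)
    (hω : ω ∈ (I ⊔ Ideal.span {x}) • (⊤ : Submodule R (ExteriorAlgebra R M))) :
    ∃ α ∈ ⋀[R]^i M, ω - x • α ∈ I • (⊤ : Submodule R (ExteriorAlgebra R M)) := by
  obtain ⟨α, hα⟩ := exists_smul_add_of_mem_sup_smul_top hω
  refine ⟨GradedAlgebra.proj (fun i : ℕ => ⋀[R]^i M) i α, ?_, ?_⟩
  · rw [GradedAlgebra.proj_apply]
    exact SetLike.coe_mem _
  · have := map_mem_ideal_smul_top (GradedAlgebra.proj (fun i : ℕ => ⋀[R]^i M) i) hα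
    rwa [map_sub, map_smul, GradedAlgebra.proj_apply,
      DirectSum.decompose_of_mem_same (fun i : ℕ => ⋀[R]^i M) hi] at this

instance [Module.Free R M] : Module.Free R (ExteriorAlgebra R M) := by
  classical
  let := linearOrderOfSTO (WellOrderingRel (α := Module.Free.ChooseBasisIndex R M))
  exact Module.Free.of_basis (Module.Free.chooseBasis R M).ExteriorAlgebra

variable [Module.Free R M] {v : M} {I : Ideal R} {x : R} {k : ℕ}

theorem KoszulExactBelow.sup_span_singleton (hx : ∀ r, x * r ∈ I → r ∈ I)
    (h : KoszulExactBelow v I (k + 1)) : KoszulExactBelow v (I ⊔ Ideal.span {x}) k := by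
  intro i hi ω hω hdω
  obtain ⟨α, hα, hα'⟩ := exists_homogeneous_smul_add_of_mem_sup_smul_top
    (ι_mul_mem_exteriorPower v hω) hdω
  have hdα : ι R v * α ∈ I • (⊤ : Submodule R (ExteriorAlgebra R M)) := by
    refine mem_ideal_smul_top_of_smul_mem hx ?_
    have := map_mem_ideal_smul_top (LinearMap.mulLeft R (ι R v)) hα'
    rw [LinearMap.mulLeft_apply, mul_sub, ι_mul_ι_mul, zero_sub, mul_smul_comm] at this
    simpa using neg_mem this
  obtain ⟨γ, hγ, hγ'⟩ := h (i + 1) (by omega) α hα hdα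
  obtain ⟨η, hη, hη'⟩ := h i (by omega) (ω - x • γ) (sub_mem hω (Submodule.smul_mem _ _ hγ)) (by
    have := add_mem hα' (Submodule.smul_mem _ x hγ')
    rw [mul_sub, mul_smul_comm]
    rwa [smul_sub, sub_add_sub_cancel] at this)
  refine ⟨η, hη, ?_⟩
  have := add_mem (Submodule.smul_mono_left (le_sup_left (b := Ideal.span {x})) hη')
    (smul_mem_sup_smul_top I x γ)
  convert this using 1
  abel

theorem KoszulExactBelow.of_sup_span_singleton (hx : ∀ r, x * r ∈ I → r ∈ I)
    (d : Module.Dual R M) (hd : d v = x)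
    (h : KoszulExactBelow v (I ⊔ Ideal.span {x}) k) : KoszulExactBelow v I (k + 1) := by
  intro i hi ω hω hdω
  have hc := CliffordAlgebra.contractLeft_ι_mul (Q := 0) d v ω
  change CliffordAlgebra.contractLeft (Q := 0) d (ι R v * ω) = _ - ι R v * _ at hc
  have hmem := map_mem_ideal_smul_top (CliffordAlgebra.contractLeft (Q := 0) d) hdω
  have hp := contractLeft_mem_prevForms d i hω
  rw [hc, hd] at hmem
  generalize CliffordAlgebra.contractLeft (Q := 0) d ω = γ at hmem hp
  cases i with
  | zero =>
    rw [prevForms, Submodule.mem_bot] at hp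
    subst hp
    refine ⟨0, zero_mem _, ?_⟩
    rw [mul_zero, sub_zero] at hmem ⊢
    exact mem_ideal_smul_top_of_smul_mem hx hmem
  | succ i =>
    have hdγ : ι R v * γ ∈ (I ⊔ Ideal.span {x}) • (⊤ : Submodule R (ExteriorAlgebra R M)) := by
      have := sub_mem (smul_mem_sup_smul_top I x ω)
        (Submodule.smul_mono_left (le_sup_left (b := Ideal.span {x})) hmem)
      rwa [sub_sub_cancel] at this
    obtain ⟨δ, hδ, hδ'⟩ := h i (by omega) γ hp hdγ
    obtain ⟨ε, hε, hε'⟩ := exists_homogeneous_smul_add_of_mem_sup_smul_top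
      (sub_mem hp (ι_mul_prevForms v hδ)) hδ'
    refine ⟨ε, hε, mem_ideal_smul_top_of_smul_mem hx ?_⟩
    have := map_mem_ideal_smul_top (LinearMap.mulLeft R (ι R v)) hε'
    rw [LinearMap.mulLeft_apply, mul_sub, mul_sub, ι_mul_ι_mul, sub_zero, mul_smul_comm] at this
    have := add_mem hmem this
    rwa [sub_add_sub_cancel, ← smul_sub] at this

end Koszul

section Dimension

variable {R : Type*} [CommRing R] {σ : Type*} [Finite σ]

theorem KoszulExactBelow.mem_of_forall_mul_mem {v : σ → R} {I : Ideal R} {k : ℕ}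
    (h : KoszulExactBelow v I (k + 1)) {r : R} (hr : ∀ j, r * v j ∈ I) : r ∈ I := by
  classical
  have := Fintype.ofFinite σ
  have hv : r • v ∈ I • (⊤ : Submodule R (σ → R)) := by
    rw [pi_eq_sum_univ (r • v)]
    exact Submodule.sum_mem _ fun j _ => Submodule.smul_mem_smul (hr j) trivial
  obtain ⟨η, hη, hη'⟩ := h 0 (Nat.succ_pos k) (algebraMap R _ r)
    (by rw [exteriorPower, pow_zero]; exact Submodule.algebraMap_mem r) (by
      have := map_mem_ideal_smul_top (ι R) hv
      rwa [map_smul, Algebra.smul_def, Algebra.commutes] at this)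
  rw [prevForms, Submodule.mem_bot] at hη
  subst hη
  have := map_mem_ideal_smul_top (algebraMapInv (R := R) (M := σ → R)).toLinearMap hη'
  rw [mul_zero, sub_zero, AlgHom.toLinearMap_apply, algebraMap_leftInverse] at this
  simpa using this

theorem KoszulExactBelow.exists_regular [IsNoetherianRing R] {v : σ → R} {I : Ideal R} {k : ℕ}
    (h : KoszulExactBelow v I (k + 1)) :
    ∃ x ∈ Ideal.span (Set.range v), ∀ r, x * r ∈ I → r ∈ I := by
  set J := Ideal.span (Set.range v)
  by_cases hd : Disjoint ((J.map (Ideal.Quotient.mk I) : Ideal (R ⧸ I)) : Set (R ⧸ I))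
      (nonZeroDivisors (R ⧸ I))
  · obtain ⟨y, hy, hy0⟩ := SetLike.exists_of_lt
      (Ideal.bot_lt_annihilator_of_disjoint_nonZeroDivisors hd)
    obtain ⟨r, rfl⟩ := Ideal.Quotient.mk_surjective y
    refine absurd ?_ hy0
    rw [Ideal.mem_bot, Ideal.Quotient.eq_zero_iff_mem]
    refine h.mem_of_forall_mul_mem fun j => ?_
    rw [← Ideal.Quotient.eq_zero_iff_mem, map_mul]
    exact Submodule.mem_annihilator.1 hy _
      (Ideal.mem_map_of_mem _ (Ideal.subset_span ⟨j, rfl⟩))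
  · obtain ⟨y, hy, hy'⟩ := Set.not_disjoint_iff.1 hd
    obtain ⟨x, hx, rfl⟩ := (Ideal.mem_map_iff_of_surjective _ Ideal.Quotient.mk_surjective).1 hy
    refine ⟨x, hx, fun r hr => ?_⟩
    rw [← Ideal.Quotient.eq_zero_iff_mem] at hr ⊢
    rw [map_mul, mul_comm] at hr
    exact (mem_nonZeroDivisors_iff.1 hy').2 _ hr

theorem _root_.ringKrullDim_quotient_sup_span_singleton_succ_le {I : Ideal R} {x : R}
    (hx : ∀ r, x * r ∈ I → r ∈ I) :
    ringKrullDim (R ⧸ (I ⊔ Ideal.span {x})) + 1 ≤ ringKrullDim (R ⧸ I) := by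
  have hx' : Ideal.Quotient.mk I x ∈ nonZeroDivisors (R ⧸ I) := by
    rw [mem_nonZeroDivisors_iff_right]
    intro y hy
    obtain ⟨r, rfl⟩ := Ideal.Quotient.mk_surjective y
    rw [← map_mul, Ideal.Quotient.eq_zero_iff_mem, mul_comm] at hy
    exact Ideal.Quotient.eq_zero_iff_mem.2 (hx r hy)
  have := ringKrullDim_quotient_succ_le_of_nonZeroDivisor hx'
  rwa [← Set.image_singleton, ← Ideal.map_span,
    ringKrullDim_eq_of_ringEquiv (DoubleQuot.quotQuotEquivQuotSup I (Ideal.span {x}))] at this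

theorem KoszulExactBelow.ringKrullDim_add_le [IsNoetherianRing R] {v : σ → R} {I : Ideal R}
    {k : ℕ} (h : KoszulExactBelow v I k) (hI : I ≤ Ideal.span (Set.range v)) :
    ringKrullDim (R ⧸ Ideal.span (Set.range v)) + k ≤ ringKrullDim (R ⧸ I) := by
  induction k generalizing I with
  | zero =>
    rw [Nat.cast_zero, add_zero]
    exact ringKrullDim_le_of_surjective (Ideal.Quotient.factor hI)
      (Ideal.Quotient.factor_surjective hI)
  | succ k ih =>
    obtain ⟨x, hx, hreg⟩ := h.exists_regular
    have := ih (h.sup_span_singleton hreg) (sup_le hI ((Ideal.span_singleton_le_iff_mem _).2 hx))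
    rw [Nat.cast_succ, ← add_assoc]
    exact (add_le_add_left this 1).trans (ringKrullDim_quotient_sup_span_singleton_succ_le hreg)

end Dimension

section Regular

open MvPolynomial

variable {F : Type*} [CommRing F]

/-- Univariate monic polynomials in distinct variables form a regular sequence. -/
theorem _root_.MvPolynomial.mem_span_of_aeval_X_mul_mem {σ : Type*} (p : σ → Polynomial F)
    {s : Set σ} {k : σ} (hk : k ∉ s) (hp : (p k).Monic) {r : MvPolynomial σ F}
    (hr : Polynomial.aeval (X k : MvPolynomial σ F) (p k) * r ∈
      Ideal.span ((fun j => Polynomial.aeval (X j : MvPolynomial σ F) (p j)) '' s)) :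
    r ∈ Ideal.span ((fun j => Polynomial.aeval (X j : MvPolynomial σ F) (p j)) '' s) := by
  classical
  set I := Ideal.span ((fun j => Polynomial.aeval (X j : MvPolynomial σ F) (p j)) '' s)
  let A := MvPolynomial σ F ⧸ I
  let ψ : MvPolynomial σ F →ₐ[F] Polynomial A :=
    aeval fun j => if j = k then Polynomial.X else Polynomial.C (Ideal.Quotient.mk I (X j))
  let ev : Polynomial A →ₐ[F] A :=
    (Polynomial.aeval (R := A) (Ideal.Quotient.mk I (X k))).restrictScalars F
  have hev : ev.comp ψ = Ideal.Quotient.mkₐ F I := by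
    ext j
    by_cases hj : j = k <;> simp [ψ, ev, hj] <;> rfl
  have hψI : ∀ g ∈ I, ψ g = 0 := by
    intro g hg
    refine (Ideal.span_le (I := RingHom.ker ψ)).2 ?_ hg
    rintro _ ⟨j, hj, rfl⟩
    have hjk : j ≠ k := fun h => hk (h ▸ hj)
    rw [SetLike.mem_coe, RingHom.mem_ker, ← Polynomial.aeval_algHom_apply]
    have h1 : ψ (X j) = (Polynomial.CAlgHom (R := F) (A := A)) (Ideal.Quotient.mkₐ F I (X j)) := by
      simp [ψ, hjk]
    rw [h1, Polynomial.aeval_algHom_apply, Polynomial.aeval_algHom_apply]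
    have : Ideal.Quotient.mkₐ F I (Polynomial.aeval (X j : MvPolynomial σ F) (p j)) = 0 :=
      Ideal.Quotient.eq_zero_iff_mem.2 (Ideal.subset_span ⟨j, hj, rfl⟩)
    rw [this, map_zero]
  have hψk : ψ (Polynomial.aeval (X k : MvPolynomial σ F) (p k)) = (p k).map (algebraMap F A) := by
    rw [← Polynomial.aeval_algHom_apply]
    simp [ψ, Polynomial.aeval_X_left_eq_map]
    rfl
  have hmul := hψI _ hr
  rw [map_mul, hψk, (hp.map (algebraMap F A)).mul_right_eq_zero_iff] at hmul
  have := DFunLike.congr_fun hev r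
  rw [AlgHom.comp_apply, hmul, map_zero] at this
  exact Ideal.Quotient.eq_zero_iff_mem.1 this.symm

theorem koszulExactBelow_of_aeval_X_mem {n : ℕ} {τ : Type*} [Finite τ]
    (p : Fin n → Polynomial F) (hp : ∀ i, (p i).Monic) (v : τ → MvPolynomial (Fin n) F)
    (hv : ∀ i, Polynomial.aeval (X i : MvPolynomial (Fin n) F) (p i) ∈
      Ideal.span (Set.range v)) : KoszulExactBelow v (⊥ : Ideal (MvPolynomial (Fin n) F)) n := by
  classical
  have := Fintype.ofFinite τ
  suffices ∀ k ≤ n, KoszulExactBelow v (Ideal.span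
      ((fun j => Polynomial.aeval (X j : MvPolynomial (Fin n) F) (p j)) ''
        {j | (j : ℕ) < n - k})) k by
    simpa using this n le_rfl
  intro k hk
  induction k with
  | zero => exact koszulExactBelow_zero _ _
  | succ k ih =>
    let j : Fin n := ⟨n - (k + 1), by omega⟩
    obtain ⟨c, hc⟩ := (Submodule.mem_span_range_iff_exists_fun _).1 (hv j)
    refine KoszulExactBelow.of_sup_span_singleton
      (fun r hr => mem_span_of_aeval_X_mul_mem p (by simp [j]) (hp j) hr)
      (∑ i, c i • LinearMap.proj i) (by simpa using hc) ?_
    convert ih (by omega) using 1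
    rw [← Ideal.span_union, ← Set.image_singleton
      (f := fun j => Polynomial.aeval (X j : MvPolynomial (Fin n) F) (p j)), ← Set.image_union]
    congr 2
    ext i
    simp only [Set.mem_union, Set.mem_ofPred_eq, Set.mem_singleton_iff, Fin.ext_iff, j]
    omega

theorem KoszulExactBelow.finite_quotient {K : Type*} [Field K] {n : ℕ} {τ : Type*} [Finite τ]
    {v : τ → MvPolynomial (Fin n) K}
    (h : KoszulExactBelow v (⊥ : Ideal (MvPolynomial (Fin n) K)) n) :
    Module.Finite K (MvPolynomial (Fin n) K ⧸ Ideal.span (Set.range v)) := by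
  have hdim := h.ringKrullDim_add_le bot_le
  have hbot : ringKrullDim (MvPolynomial (Fin n) K ⧸ (⊥ : Ideal (MvPolynomial (Fin n) K))) =
      0 + (n : WithBot ℕ∞) := by
    rw [ringKrullDim_eq_of_ringEquiv (RingEquiv.quotientBot (MvPolynomial (Fin n) K)),
      MvPolynomial.ringKrullDim_of_isNoetherianRing, ringKrullDim_eq_zero_of_field, Nat.card_fin]
  rw [hbot, ENat.WithBot.add_le_add_natCast_right_iff] at hdim
  exact (Module.finite_iff_krullDimLE_zero K _).2 (Ring.krullDimLE_iff.2 (by exact_mod_cast hdim))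

end Regular

end ExteriorAlgebra

section Critical

open MvPolynomial

variable {F : Type*} [Field F]

theorem MvPolynomial.exists_monic_aeval_X_mem_of_finite_zeroLocus {σ : Type*} [Finite σ]
    (K : Type*) [Field K] [Algebra F K] [IsAlgClosed K] [Algebra.IsAlgebraic F K]
    (J : Ideal (MvPolynomial σ F)) (hfin : (zeroLocus K J).Finite) (i : σ) :
    ∃ p : Polynomial F, p.Monic ∧ Polynomial.aeval (X i : MvPolynomial σ F) p ∈ J := by
  let g : Polynomial F := ∏ a ∈ hfin.toFinset, minpoly F (a i)
  have hg : g.Monic := Polynomial.monic_prod_of_monic _ _ fun a _ =>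
    minpoly.monic (Algebra.IsIntegral.isIntegral (a i))
  have hmem : Polynomial.aeval (X i : MvPolynomial σ F) g ∈ J.radical := by
    rw [← vanishingIdeal_zeroLocus_eq_radical (K := K), mem_vanishingIdeal_iff]
    intro a ha
    rw [← Polynomial.aeval_algHom_apply, aeval_X, map_prod]
    exact Finset.prod_eq_zero (hfin.mem_toFinset.2 ha) (minpoly.aeval F (a i))
  obtain ⟨N, hN⟩ := hmem
  exact ⟨g ^ N, hg.pow N, by rwa [map_pow]⟩

theorem MvPolynomial.finite_quotient_of_aeval_X_mem {σ : Type*} [Finite σ]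
    (J : Ideal (MvPolynomial σ F))
    (h : ∀ i, ∃ p : Polynomial F, p.Monic ∧ Polynomial.aeval (X i : MvPolynomial σ F) p ∈ J) :
    Module.Finite F (MvPolynomial σ F ⧸ J) := by
  have hint : Algebra.IsIntegral F (MvPolynomial σ F ⧸ J) := by
    refine ⟨fun y => ?_⟩
    obtain ⟨r, rfl⟩ := Ideal.Quotient.mk_surjective y
    have hX : ∀ i, IsIntegral F (Ideal.Quotient.mkₐ F J (X i)) := fun i => by
      obtain ⟨p, hp, hpJ⟩ := h i
      refine ⟨p, hp, ?_⟩
      rw [← Polynomial.aeval_def, Polynomial.aeval_algHom_apply]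
      exact Ideal.Quotient.eq_zero_iff_mem.2 hpJ
    induction r using MvPolynomial.induction_on with
    | C a => exact isIntegral_algebraMap (R := F) (A := MvPolynomial σ F ⧸ J) (x := a)
    | add p q hp hq => rw [map_add]; exact hp.add hq
    | mul_X p i hp => rw [map_mul]; exact hp.mul (hX i)
  exact Algebra.IsIntegral.finite

theorem MvPolynomial.finite_zeroLocus_of_finite_quotient {σ : Type*} [Finite σ]
    (K : Type*) [Field K] [Algebra F K] (J : Ideal (MvPolynomial σ F))
    [Module.Finite F (MvPolynomial σ F ⧸ J)] : (zeroLocus K J).Finite := by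
  have h (i : σ) : ∃ p : Polynomial F, p.Monic ∧
      Polynomial.aeval (X i : MvPolynomial σ F) p ∈ J := by
    obtain ⟨p, hp, hp0⟩ := Algebra.IsIntegral.isIntegral (R := F) (Ideal.Quotient.mkₐ F J (X i))
    rw [← Polynomial.aeval_def, Polynomial.aeval_algHom_apply] at hp0
    exact ⟨p, hp, Ideal.Quotient.eq_zero_iff_mem.1 hp0⟩
  choose p hp hpJ using h
  refine (Set.Finite.pi' fun i => (p i).rootSet_finite K).subset fun a ha i => ?_
  rw [Polynomial.mem_rootSet]
  refine ⟨(hp i).ne_zero, ?_⟩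
  have := ha _ (hpJ i)
  rwa [← Polynomial.aeval_algHom_apply, aeval_X] at this

end Critical

section Forms

variable {F : Type} [Field F] {n : ℕ}

theorem wedgeMonomial_eq_smul_ιMulti (k : ℕ) (s : Fin k → Fin n) (c : PolyRing F n) :
    wedgeMonomial k s c = c • ExteriorAlgebra.ιMulti (PolyRing F n) k
      (fun i => Pi.single (s i) (1 : PolyRing F n)) := by
  rw [ExteriorAlgebra.ιMulti_apply]
  rfl

theorem isForm_iff {k : ℕ} {ω : FormAlgebra F n} :
    IsForm k ω ↔ ω ∈ ⋀[PolyRing F n]^k (Fin n → PolyRing F n) := by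
  constructor
  · intro h
    induction h using AddSubgroup.closure_induction with
    | mem x hx =>
      obtain ⟨s, c, rfl⟩ := hx
      rw [wedgeMonomial_eq_smul_ιMulti]
      exact Submodule.smul_mem _ _ (ExteriorAlgebra.ιMulti_range _ _ ⟨_, rfl⟩)
    | zero => exact zero_mem _
    | add x y _ _ hx hy => exact add_mem hx hy
    | neg x _ hx => exact neg_mem hx
  · intro h
    rw [← exteriorPower.ιMulti_family_span_fixedDegree_of_span (PolyRing F n)
      (Pi.basisFun (PolyRing F n) (Fin n)).span_eq] at h
    induction h using Submodule.closure_induction with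
    | zero => exact zero_mem _
    | add x y _ _ hx hy => exact add_mem hx hy
    | smul_mem c x hx =>
      obtain ⟨s, rfl⟩ := hx
      refine AddSubgroup.subset_closure ⟨Set.powersetCard.ofFinEmbEquiv.symm s, c, ?_⟩
      rw [wedgeMonomial_eq_smul_ιMulti]
      congr 1
      refine congrArg (ExteriorAlgebra.ιMulti (PolyRing F n) k) (funext fun i => ?_)
      simp

theorem isForm_eq_zero_of_lt {k : ℕ} (hk : n < k) {ω : FormAlgebra F n} (h : IsForm k ω) :
    ω = 0 := by
  induction h using AddSubgroup.closure_induction with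
  | mem x hx =>
    obtain ⟨s, c, rfl⟩ := hx
    rw [wedgeMonomial_eq_smul_ιMulti, ExteriorAlgebra.ιMulti_eq_zero_of_not_inj, smul_zero]
    intro hinj
    refine absurd (Fintype.card_le_of_injective s fun i j hij => hinj ?_) (by simpa using hk)
    simp only [hij]
  | zero => rfl
  | add x y _ _ hx hy => rw [hx, hy, add_zero]
  | neg x _ hx => rw [hx, neg_zero]

theorem cohomology_vanishes_iff_koszulExactBelow (f : PolyRing F n) :
    (∀ i : ℕ, i ≠ n → ∀ ω : FormAlgebra F n, IsForm i ω → dform f * ω = 0 →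
        ∃ η : FormAlgebra F n, IsForm (i - 1) η ∧ ω = dform f * η) ↔
      ExteriorAlgebra.KoszulExactBelow (fun j => MvPolynomial.pderiv j f)
        (⊥ : Ideal (PolyRing F n)) n := by
  simp only [ExteriorAlgebra.KoszulExactBelow, Submodule.bot_smul, Submodule.mem_bot,
    sub_eq_zero, isForm_iff]
  constructor
  · intro h i hi ω hω hdω
    obtain ⟨η, hη, hωη⟩ := h i hi.ne ω hω hdω
    cases i with
    | zero =>
      refine ⟨0, zero_mem _, ?_⟩
      rw [mul_zero]
      by_contra h0
      exact absurd (DirectSum.degree_eq_of_mem_mem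
        (fun i : ℕ => ⋀[PolyRing F n]^i (Fin n → PolyRing F n)) hω
        (hωη ▸ ExteriorAlgebra.ι_mul_mem_exteriorPower _ hη) h0) (by simp)
    | succ i => exact ⟨η, hη, hωη⟩
  · intro h i hi ω hω hdω
    rcases hi.lt_or_gt with hlt | hgt
    · obtain ⟨η, hη, hωη⟩ := h i hlt ω hω hdω
      cases i with
      | zero => exact ⟨η, (Submodule.mem_bot (PolyRing F n)).1 hη ▸ zero_mem _, hωη⟩
      | succ i => exact ⟨η, hη, hωη⟩
    · exact ⟨0, zero_mem _, by rw [mul_zero, isForm_eq_zero_of_lt hgt (isForm_iff.2 hω)]⟩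

end Forms

section TopForms

variable {F : Type} [Field F] {n : ℕ}

/-- The top form `dx_1 ∧ ⋯ ∧ dx_n`. -/
noncomputable def volumeForm (F : Type) [Field F] (n : ℕ) : FormAlgebra F n :=
  ExteriorAlgebra.ιMulti (PolyRing F n) n fun i => Pi.single i (1 : PolyRing F n)

theorem volumeForm_mem_exteriorPower :
    volumeForm F n ∈ ⋀[PolyRing F n]^n (Fin n → PolyRing F n) :=
  ExteriorAlgebra.ιMulti_range _ _ ⟨_, rfl⟩

theorem smul_volumeForm_injective :
    Function.Injective fun r : PolyRing F n => r • volumeForm F n := by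
  let D : FormAlgebra F n →ₗ[PolyRing F n] PolyRing F n :=
    ExteriorAlgebra.liftAlternating (Pi.single n Matrix.detRowAlternating)
  have hD : D (volumeForm F n) = 1 := by
    simp only [D, volumeForm, ExteriorAlgebra.liftAlternating_apply_ιMulti, Pi.single_eq_same]
    have h1 : (fun i => Pi.single i (1 : PolyRing F n)) = (1 : Matrix (Fin n) (Fin n) _) := by
      ext1 i
      ext1 j
      simp [Matrix.one_apply, Pi.single_apply, eq_comm]
    exact (congrArg Matrix.det h1).trans Matrix.det_one
  intro r r' h
  simpa [hD] using congrArg D h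

theorem exists_eq_smul_volumeForm {ω : FormAlgebra F n} (h : IsForm n ω) :
    ∃ r : PolyRing F n, ω = r • volumeForm F n := by
  induction h using AddSubgroup.closure_induction with
  | mem x hx =>
    obtain ⟨s, c, rfl⟩ := hx
    rw [wedgeMonomial_eq_smul_ιMulti]
    by_cases hs : Function.Injective s
    · let σ : Equiv.Perm (Fin n) := Equiv.ofBijective s (Finite.injective_iff_bijective.1 hs)
      have := AlternatingMap.map_perm (ExteriorAlgebra.ιMulti (PolyRing F n) n)
        (fun i => Pi.single i (1 : PolyRing F n)) σ
      refine ⟨c * ((Equiv.Perm.sign σ : ℤ) : PolyRing F n), ?_⟩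
      rw [mul_smul, Int.cast_smul_eq_zsmul]
      exact congrArg (c • ·) this
    · refine ⟨0, ?_⟩
      rw [ExteriorAlgebra.ιMulti_eq_zero_of_not_inj, smul_zero, zero_smul]
      exact fun hinj => hs fun i j hij => hinj (by simp only [hij])
  | zero => exact ⟨0, by rw [zero_smul]⟩
  | add x y _ _ hx hy =>
    obtain ⟨a, rfl⟩ := hx
    obtain ⟨b, rfl⟩ := hy
    exact ⟨a + b, by rw [add_smul]⟩
  | neg x _ hx =>
    obtain ⟨a, rfl⟩ := hx
    exact ⟨-a, by rw [neg_smul]⟩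

theorem isForm_smul_volumeForm (r : PolyRing F n) : IsForm n (r • volumeForm F n) :=
  isForm_iff.2 (Submodule.smul_mem _ r volumeForm_mem_exteriorPower)

theorem mem_formSubspace {k : ℕ} {ω : FormAlgebra F n} : ω ∈ formSubspace F n k ↔ IsForm k ω := by
  refine ⟨fun h => ?_, fun h => Submodule.subset_span h⟩
  induction h using Submodule.span_induction with
  | mem x hx => exact hx
  | zero => exact zero_mem _
  | add x y _ _ hx hy => exact add_mem hx hy
  | smul c x _ hx =>
    change IsForm k ((MvPolynomial.C c : PolyRing F n) • x)
    exact isForm_iff.2 (Submodule.smul_mem _ _ (isForm_iff.1 hx))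

theorem dform_eq_sum (f : PolyRing F n) :
    dform f = ∑ j, MvPolynomial.pderiv j f •
      ExteriorAlgebra.ι (PolyRing F n) (Pi.single j (1 : PolyRing F n)) := by
  rw [dform]
  simp_rw [← map_smul, ← map_sum]
  congr 1
  ext1 i
  simp [Finset.sum_apply, Pi.single_apply]

theorem smul_volumeForm_mem_boundarySubspace (f : PolyRing F n) (r : PolyRing F n) :
    r • volumeForm F n ∈ boundarySubspace F n f n ↔
      r ∈ Ideal.span (Set.range fun j => MvPolynomial.pderiv j f) := by
  constructor
  · intro h
    suffices ∀ ω ∈ boundarySubspace F n f n,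
        ∃ a ∈ Ideal.span (Set.range fun j => MvPolynomial.pderiv j f), ω = a • volumeForm F n by
      obtain ⟨a, ha, hra⟩ := this _ h
      rwa [smul_volumeForm_injective hra]
    intro ω hω
    induction hω using Submodule.span_induction with
    | mem x hx =>
      obtain ⟨η, hη, rfl⟩ := hx
      have key (j : Fin n) : ∃ c : PolyRing F n,
          ExteriorAlgebra.ι (PolyRing F n) (Pi.single j (1 : PolyRing F n)) * η =
            c • volumeForm F n := by
        apply exists_eq_smul_volumeForm
        have := ExteriorAlgebra.ι_mul_mem_exteriorPower
          (Pi.single j (1 : PolyRing F n)) (isForm_iff.1 hη)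
        rwa [Nat.sub_add_cancel (j.pos), ← isForm_iff] at this
      choose c hc using key
      refine ⟨∑ j, MvPolynomial.pderiv j f * c j, Ideal.sum_mem _ fun j _ =>
        Ideal.mul_mem_right _ _ (Ideal.subset_span ⟨j, rfl⟩), ?_⟩
      rw [dform_eq_sum, Finset.sum_mul, Finset.sum_smul]
      exact Finset.sum_congr rfl fun j _ => by rw [smul_mul_assoc, hc, mul_smul]
    | zero => exact ⟨0, zero_mem _, by rw [zero_smul]⟩
    | add x y _ _ hx hy =>
      obtain ⟨a, ha, rfl⟩ := hx
      obtain ⟨b, hb, rfl⟩ := hy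
      exact ⟨a + b, add_mem ha hb, by rw [add_smul]⟩
    | smul c x _ hx =>
      obtain ⟨a, ha, rfl⟩ := hx
      exact ⟨MvPolynomial.C c * a, Ideal.mul_mem_left _ _ ha,
        (mul_smul (MvPolynomial.C c : PolyRing F n) a (volumeForm F n)).symm⟩
  · intro hr
    obtain ⟨c, rfl⟩ := (Submodule.mem_span_range_iff_exists_fun _).1 hr
    rw [Finset.sum_smul]
    refine Submodule.sum_mem _ fun j _ => Submodule.subset_span
      ⟨c j • CliffordAlgebra.contractLeft (Q := 0) (LinearMap.proj j) (volumeForm F n), ?_, ?_⟩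
    · have := ExteriorAlgebra.contractLeft_mem_prevForms
        (LinearMap.proj (R := PolyRing F n) (φ := fun _ => PolyRing F n) j) n
        (volumeForm_mem_exteriorPower (F := F))
      rw [isForm_iff]
      refine Submodule.smul_mem _ _ ?_
      obtain ⟨m, rfl⟩ : ∃ m, n = m + 1 := ⟨n - 1, (Nat.sub_add_cancel j.pos).symm⟩
      exact this
    · have hc := CliffordAlgebra.contractLeft_ι_mul (Q := 0)
        (LinearMap.proj (R := PolyRing F n) (φ := fun _ => PolyRing F n) j)
        (fun j => MvPolynomial.pderiv j f) (volumeForm F n)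
      change CliffordAlgebra.contractLeft (Q := 0) _ (dform f * volumeForm F n) =
        _ - dform f * _ at hc
      have h0 : dform f * volumeForm F n = 0 :=
        isForm_eq_zero_of_lt (Nat.lt_succ_self n) (isForm_iff.2
          (ExteriorAlgebra.ι_mul_mem_exteriorPower _ volumeForm_mem_exteriorPower))
      rw [h0, map_zero, eq_comm, sub_eq_zero] at hc
      rw [mul_smul_comm, ← hc, smul_smul]
      rfl

/-- `H^n(Ω^·, φ_f)` is the Milnor algebra of `f`. -/
noncomputable def topCohomologyEquiv (f : PolyRing F n) :
    (PolyRing F n ⧸ Ideal.span (Set.range fun j => MvPolynomial.pderiv j f)) ≃ₗ[F]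
      topCohomology F n f :=
  let g : PolyRing F n →ₗ[F] formSubspace F n n :=
    { toFun := fun r => ⟨r • volumeForm F n, mem_formSubspace.2 (isForm_smul_volumeForm r)⟩
      map_add' := fun a b => Subtype.ext (add_smul a b _)
      map_smul' := fun c a => Subtype.ext <|
        (congrArg (· • volumeForm F n) (MvPolynomial.smul_eq_C_mul a c)).trans (mul_smul _ _ _) }
  let h := ((boundarySubspace F n f n).comap (formSubspace F n n).subtype).mkQ.comp g
  have hker : (Ideal.span (Set.range fun j => MvPolynomial.pderiv j f)).restrictScalars F =
      LinearMap.ker h := by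
    ext r
    rw [LinearMap.mem_ker, LinearMap.comp_apply, Submodule.mkQ_apply,
      Submodule.Quotient.mk_eq_zero]
    exact (smul_volumeForm_mem_boundarySubspace f r).symm
  have hsurj : Function.Surjective h := by
    refine (Submodule.mkQ_surjective _).comp fun ω => ?_
    obtain ⟨r, hr⟩ := exists_eq_smul_volumeForm (mem_formSubspace.1 ω.2)
    exact ⟨r, Subtype.ext hr.symm⟩
  (Submodule.Quotient.restrictScalarsEquiv F _).symm ≪≫ₗ
    Submodule.quotEquivOfEq _ _ hker ≪≫ₗ h.quotKerEquivOfSurjective hsurj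

end TopForms

theorem criticalPoints_eq_zeroLocus {F : Type} [Field F] {n : ℕ} (f : MvPolynomial (Fin n) F) :
    {x : Fin n → AlgebraicClosure F | ∀ j, MvPolynomial.eval x
          (MvPolynomial.map (algebraMap F (AlgebraicClosure F)) (MvPolynomial.pderiv j f)) = 0} =
      zeroLocus (AlgebraicClosure F) (Ideal.span (Set.range fun j => MvPolynomial.pderiv j f)) := by
  ext x
  rw [zeroLocus_span]
  simp [MvPolynomial.eval_map, MvPolynomial.aeval_def]

/-- `f` has only isolated critical points (finitely many common zeros of its partial
derivatives over an algebraic closure) iff `H^i(Ω^·, φ_f) = 0` for all `i ≠ n`; and either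
condition implies `dim_F H^n(Ω^·, φ_f) = dim_F F[x]/(∂f/∂x_1,…,∂f/∂x_n)` is finite. -/
theorem isolated_critical_points_iff_cohomology_vanishes
    {F : Type} [Field F] [Fintype F] {n : ℕ} (f : MvPolynomial (Fin n) F) :
    (({x : Fin n → AlgebraicClosure F | ∀ j, MvPolynomial.eval x
          (MvPolynomial.map (algebraMap F (AlgebraicClosure F))
            (MvPolynomial.pderiv j f)) = 0}).Finite ↔
      (∀ i : ℕ, i ≠ n → ∀ ω : FormAlgebra F n, IsForm i ω → dform f * ω = 0 →
        ∃ η : FormAlgebra F n, IsForm (i - 1) η ∧ ω = dform f * η)) ∧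
    (({x : Fin n → AlgebraicClosure F | ∀ j, MvPolynomial.eval x
          (MvPolynomial.map (algebraMap F (AlgebraicClosure F))
            (MvPolynomial.pderiv j f)) = 0}).Finite →
      FiniteDimensional F (MvPolynomial (Fin n) F ⧸
        Ideal.span (Set.range fun j => MvPolynomial.pderiv j f)) ∧
      FiniteDimensional F (topCohomology F n f) ∧
      Module.finrank F (topCohomology F n f) =
        Module.finrank F (MvPolynomial (Fin n) F ⧸
          Ideal.span (Set.range fun j => MvPolynomial.pderiv j f))) := by
  rw [criticalPoints_eq_zeroLocus, cohomology_vanishes_iff_koszulExactBelow]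
  set J := Ideal.span (Set.range fun j => MvPolynomial.pderiv j f)
  have hmonic (h : (zeroLocus (AlgebraicClosure F) J).Finite) :=
    exists_monic_aeval_X_mem_of_finite_zeroLocus (AlgebraicClosure F) J h
  refine ⟨⟨fun h => ?_, fun h => ?_⟩, fun h => ?_⟩
  · choose p hp hpJ using hmonic h
    exact ExteriorAlgebra.koszulExactBelow_of_aeval_X_mem p hp _ hpJ
  · have := h.finite_quotient
    exact finite_zeroLocus_of_finite_quotient _ J
  · have hfin : Module.Finite F (MvPolynomial (Fin n) F ⧸ J) :=
      finite_quotient_of_aeval_X_mem J (hmonic h)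
    exact ⟨hfin, Module.Finite.equiv (topCohomologyEquiv f),
      (topCohomologyEquiv f).finrank_eq.symm⟩
end

section
/- Let 𝔽_q be a finite field and f ∈ 𝔽_q[x_1,…,x_n] of degree δ with highest-degree homogeneous part f^{(δ)}. If ∂f^{(δ)}/∂x_1, …, ∂f^{(δ)}/∂x_n form a regular sequence in 𝔽_q[x_1,…,x_n], then: (i) H^i(Ω^·, φ_f) = 0 for all i ≠ n; and (ii) dim_{𝔽_q} 𝔽_q[x_1,…,x_n]/(∂f/∂x_1,…,∂f/∂x_n) = (δ-1)^n. In particular, dim_{𝔽_q} H^n(Ω^·, φ_f) = (δ-1)^n. -/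
set_option synthInstance.maxHeartbeats 1000000
set_option maxHeartbeats 1000000
open MvPolynomial

section KoszulCochain

variable {R M : Type*} [CommRing R] [AddCommGroup M] [Module R M]

/-- The span of the `d`-fold wedge products of distinct vectors among `e 0, …, e (k - 1)`;
it is zero unless `0 ≤ d ≤ k`. -/
noncomputable def wedgeSpan (e : ℕ → M) : ℕ → ℤ → Submodule R (ExteriorAlgebra R M)
  | 0, d => if d = 0 then Submodule.span R {1} else ⊥
  | k + 1, d => wedgeSpan e k d ⊔
      (wedgeSpan e k (d - 1)).map (LinearMap.mulLeft R (ExteriorAlgebra.ι R (e k)))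

/-- The vector `∑ j < k, g j • e j` of the exterior algebra. -/
noncomputable def koszulVector (e : ℕ → M) (g : ℕ → R) (k : ℕ) : ExteriorAlgebra R M :=
  ExteriorAlgebra.ι R (∑ j ∈ Finset.range k, g j • e j)

/-- The wedge product `e (k - 1) ∧ ⋯ ∧ e 0`. -/
noncomputable def volumeElement (R : Type*) {M : Type*} [CommRing R] [AddCommGroup M] [Module R M]
    (e : ℕ → M) : ℕ → ExteriorAlgebra R M
  | 0 => 1
  | k + 1 => ExteriorAlgebra.ι R (e k) * volumeElement R e k

/-- The ideal generated by `g 0, …, g (k - 1)`. -/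
def initialIdeal (g : ℕ → R) : ℕ → Ideal R
  | 0 => ⊥
  | k + 1 => initialIdeal g k ⊔ Ideal.span {g k}

theorem mem_initialIdeal_succ {g : ℕ → R} {k : ℕ} {a : R} :
    a ∈ initialIdeal g (k + 1) ↔ ∃ b ∈ initialIdeal g k, ∃ c, a = b + c * g k := by
  simp only [initialIdeal, Submodule.mem_sup, Ideal.mem_span_singleton']
  constructor
  · rintro ⟨b, hb, _, ⟨c, rfl⟩, rfl⟩
    exact ⟨b, hb, c, rfl⟩
  · rintro ⟨b, hb, c, rfl⟩
    exact ⟨b, hb, _, ⟨c, rfl⟩, rfl⟩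

theorem initialIdeal_le_succ (g : ℕ → R) (k : ℕ) : initialIdeal g k ≤ initialIdeal g (k + 1) :=
  le_sup_left

theorem initialIdeal_eq_span (g : ℕ → R) (k : ℕ) :
    initialIdeal g k = Ideal.span (g '' Set.Iio k) := by
  induction k with
  | zero => simp [initialIdeal]
  | succ k ih =>
    have : Set.Iio (k + 1) = insert k (Set.Iio k) := by
      ext; simp only [Set.mem_Iio, Set.mem_insert_iff]; omega
    rw [initialIdeal, ih, this, Set.image_insert_eq, Ideal.span_insert, sup_comm]

theorem ι_mul_ι_mul_self (m : M) (x : ExteriorAlgebra R M) :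
    ExteriorAlgebra.ι R m * (ExteriorAlgebra.ι R m * x) = 0 := by
  rw [← mul_assoc, ExteriorAlgebra.ι_sq_zero, zero_mul]

theorem ι_mul_ι_mul_swap (m m' : M) (x : ExteriorAlgebra R M) :
    ExteriorAlgebra.ι R m * (ExteriorAlgebra.ι R m' * x) =
      -(ExteriorAlgebra.ι R m' * (ExteriorAlgebra.ι R m * x)) := by
  rw [← mul_assoc, ← mul_assoc, ← neg_mul]
  congr 1
  exact eq_neg_of_add_eq_zero_left (ExteriorAlgebra.ι_add_mul_swap m m')

variable {e : ℕ → M} {g : ℕ → R}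

theorem mem_wedgeSpan_succ {k : ℕ} {d : ℤ} {ω : ExteriorAlgebra R M} :
    ω ∈ wedgeSpan (R := R) e (k + 1) d ↔ ∃ α ∈ wedgeSpan (R := R) e k d,
      ∃ β ∈ wedgeSpan (R := R) e k (d - 1), ω = α + ExteriorAlgebra.ι R (e k) * β := by
  simp only [wedgeSpan, Submodule.mem_sup, Submodule.mem_map, LinearMap.mulLeft_apply]
  constructor
  · rintro ⟨α, hα, _, ⟨β, hβ, rfl⟩, rfl⟩
    exact ⟨α, hα, β, hβ, rfl⟩
  · rintro ⟨α, hα, β, hβ, rfl⟩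
    exact ⟨α, hα, _, ⟨β, hβ, rfl⟩, rfl⟩

theorem wedgeSpan_le_succ (k : ℕ) (d : ℤ) :
    wedgeSpan (R := R) e k d ≤ wedgeSpan e (k + 1) d :=
  le_sup_left

theorem ι_mul_mem_wedgeSpan_succ {k : ℕ} {d : ℤ} {β : ExteriorAlgebra R M}
    (hβ : β ∈ wedgeSpan e k d) :
    ExteriorAlgebra.ι R (e k) * β ∈ wedgeSpan e (k + 1) (d + 1) :=
  mem_wedgeSpan_succ.2 ⟨0, zero_mem _, β, by simpa using hβ, by simp⟩

theorem wedgeSpan_eq_bot_of_neg (k : ℕ) {d : ℤ} (hd : d < 0) :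
    wedgeSpan (R := R) e k d = ⊥ := by
  induction k generalizing d with
  | zero => simp [wedgeSpan, hd.ne]
  | succ k ih => simp [wedgeSpan, ih hd, ih (show d - 1 < 0 by omega)]

theorem wedgeSpan_eq_bot_of_lt {k : ℕ} {d : ℤ} (hd : (k : ℤ) < d) :
    wedgeSpan (R := R) e k d = ⊥ := by
  induction k generalizing d with
  | zero => simp only [wedgeSpan]; rw [if_neg]; simpa using hd.ne'
  | succ k ih =>
    push_cast at hd
    simp [wedgeSpan, ih (show (k : ℤ) < d by omega), ih (show (k : ℤ) < d - 1 by omega)]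

theorem ι_mul_mem_wedgeSpan {k j : ℕ} (hj : j < k) {d : ℤ} {ω : ExteriorAlgebra R M}
    (hω : ω ∈ wedgeSpan e k d) :
    ExteriorAlgebra.ι R (e j) * ω ∈ wedgeSpan e k (d + 1) := by
  induction k generalizing d ω with
  | zero => omega
  | succ k ih =>
    obtain ⟨α, hα, β, hβ, rfl⟩ := mem_wedgeSpan_succ.1 hω
    rw [mul_add]
    rcases Nat.lt_succ_iff_lt_or_eq.1 hj with h | rfl
    · rw [ι_mul_ι_mul_swap]
      refine add_mem (wedgeSpan_le_succ _ _ (ih h hα)) (neg_mem ?_)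
      exact ι_mul_mem_wedgeSpan_succ (by simpa using ih h hβ)
    · rw [ι_mul_ι_mul_self, add_zero]
      exact ι_mul_mem_wedgeSpan_succ hα

theorem koszulVector_zero : koszulVector e g 0 = 0 := by simp [koszulVector]

theorem koszulVector_succ (k : ℕ) :
    koszulVector e g (k + 1) = koszulVector e g k + g k • ExteriorAlgebra.ι R (e k) := by
  simp [koszulVector, Finset.sum_range_succ]

theorem koszulVector_mul_mem {k : ℕ} {d : ℤ} {ω : ExteriorAlgebra R M}
    (hω : ω ∈ wedgeSpan e k d) : koszulVector e g k * ω ∈ wedgeSpan e k (d + 1) := by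
  simp only [koszulVector, map_sum, map_smul, Finset.sum_mul, smul_mul_assoc]
  exact sum_mem fun j hj => Submodule.smul_mem _ _ (ι_mul_mem_wedgeSpan (Finset.mem_range.1 hj) hω)

theorem koszulVector_succ_mul (k : ℕ) (α β : ExteriorAlgebra R M) :
    koszulVector e g (k + 1) * (α + ExteriorAlgebra.ι R (e k) * β) =
      koszulVector e g k * α +
        ExteriorAlgebra.ι R (e k) * (g k • α - koszulVector e g k * β) := by
  have h : koszulVector e g k * (ExteriorAlgebra.ι R (e k) * β) =
      -(ExteriorAlgebra.ι R (e k) * (koszulVector e g k * β)) := ι_mul_ι_mul_swap _ _ _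
  rw [koszulVector_succ, add_mul, mul_add, mul_add, h, smul_mul_assoc, smul_mul_assoc,
    ι_mul_ι_mul_self, mul_sub, mul_smul_comm]
  simp only [smul_zero, add_zero]
  abel

/-- `e 0, …, e (n - 1)` admits functionals that are triangular with respect to it. -/
def HasTriangularDual (R : Type*) {M : Type*} [CommRing R] [AddCommGroup M] [Module R M]
    (e : ℕ → M) (n : ℕ) : Prop :=
  ∀ k < n, ∃ l : Module.Dual R M, l (e k) = 1 ∧ ∀ j < k, l (e j) = 0

theorem contractLeft_eq_zero_of_mem_wedgeSpan {l : Module.Dual R M} {k : ℕ}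
    (hl : ∀ j < k, l (e j) = 0) {d : ℤ} {ω : ExteriorAlgebra R M} (hω : ω ∈ wedgeSpan e k d) :
    CliffordAlgebra.contractLeft l ω = 0 := by
  induction k generalizing d ω with
  | zero =>
    by_cases hd : d = 0
    · simp only [wedgeSpan, if_pos hd, Submodule.mem_span_singleton] at hω
      obtain ⟨a, rfl⟩ := hω
      rw [map_smul]
      erw [CliffordAlgebra.contractLeft_one]
      simp
    · simp only [wedgeSpan, if_neg hd, Submodule.mem_bot] at hω
      simp [hω]
  | succ k ih =>
    obtain ⟨α, hα, β, hβ, rfl⟩ := mem_wedgeSpan_succ.1 hω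
    have hl' : ∀ j < k, l (e j) = 0 := fun j hj => hl j (by omega)
    rw [map_add, ih hl' hα]
    erw [CliffordAlgebra.contractLeft_ι_mul]
    rw [ih hl' hβ, hl k (by omega)]
    simp

theorem wedgeSpan_decomposition_unique {n k : ℕ} (he : HasTriangularDual R e n) (hk : k < n)
    {d d' : ℤ} {α β : ExteriorAlgebra R M} (hα : α ∈ wedgeSpan e k d) (hβ : β ∈ wedgeSpan e k d')
    (h : α + ExteriorAlgebra.ι R (e k) * β = 0) : α = 0 ∧ β = 0 := by
  obtain ⟨l, hl, hl'⟩ := he k hk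
  have hβ0 : β = 0 := by
    have := congrArg (CliffordAlgebra.contractLeft l) h
    rw [map_add, contractLeft_eq_zero_of_mem_wedgeSpan hl' hα] at this
    erw [CliffordAlgebra.contractLeft_ι_mul] at this
    rw [contractLeft_eq_zero_of_mem_wedgeSpan hl' hβ, hl] at this
    simpa using this
  subst hβ0
  simpa using h

theorem volumeElement_mem (k : ℕ) : volumeElement R e k ∈ wedgeSpan (R := R) e k k := by
  induction k with
  | zero => simp [volumeElement, wedgeSpan, Submodule.mem_span_singleton_self]
  | succ k ih => exact_mod_cast ι_mul_mem_wedgeSpan_succ ih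

theorem wedgeSpan_self (k : ℕ) :
    wedgeSpan (R := R) e k k = Submodule.span R {volumeElement R e k} := by
  induction k with
  | zero => simp [volumeElement, wedgeSpan]
  | succ k ih =>
    rw [wedgeSpan, wedgeSpan_eq_bot_of_lt (by push_cast; omega)]
    push_cast
    rw [add_sub_cancel_right, ih, Submodule.map_span]
    simp [volumeElement]

theorem smul_volumeElement_eq_zero {n k : ℕ} (he : HasTriangularDual R e n) (hk : k ≤ n) {c : R}
    (h : c • volumeElement R e k = 0) : c = 0 := by
  induction k with
  | zero =>
    have := congrArg ExteriorAlgebra.algebraMapInv h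
    simpa [volumeElement] using this
  | succ k ih =>
    refine ih (by omega) (wedgeSpan_decomposition_unique he hk (d := 0) (zero_mem _)
      (Submodule.smul_mem _ c (volumeElement_mem k)) ?_).2
    simpa [volumeElement] using h

theorem koszulVector_mul_mem_top {k : ℕ} {η : ExteriorAlgebra R M}
    (hη : η ∈ wedgeSpan e k (k - 1)) :
    ∃ c ∈ initialIdeal g k, koszulVector e g k * η = c • volumeElement R e k := by
  induction k generalizing η with
  | zero => exact ⟨0, zero_mem _, by simp [koszulVector_zero]⟩
  | succ k ih =>
    push_cast at hη
    rw [add_sub_cancel_right] at hη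
    obtain ⟨α, hα, β, hβ, rfl⟩ := mem_wedgeSpan_succ.1 hη
    obtain ⟨b, hb, hbβ⟩ := ih hβ
    have hα0 : koszulVector e g k * α = 0 := by
      have := koszulVector_mul_mem (g := g) hα
      rwa [wedgeSpan_eq_bot_of_lt (by omega), Submodule.mem_bot] at this
    rw [wedgeSpan_self, Submodule.mem_span_singleton] at hα
    obtain ⟨a, rfl⟩ := hα
    refine ⟨-b + a * g k, mem_initialIdeal_succ.2 ⟨-b, neg_mem hb, a, rfl⟩, ?_⟩
    rw [koszulVector_succ_mul, hα0, hbβ, volumeElement, smul_smul, ← sub_smul, mul_smul_comm]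
    rw [zero_add]
    congr 1
    ring

theorem exists_koszulVector_mul_eq_smul_volumeElement {k : ℕ} {c : R}
    (hc : c ∈ initialIdeal g k) :
    ∃ η ∈ wedgeSpan e k (k - 1), koszulVector e g k * η = c • volumeElement R e k := by
  induction k generalizing c with
  | zero =>
    simp only [initialIdeal, Ideal.mem_bot] at hc
    exact ⟨0, zero_mem _, by simp [hc]⟩
  | succ k ih =>
    obtain ⟨b, hb, a, rfl⟩ := mem_initialIdeal_succ.1 hc
    obtain ⟨β, hβ, hbβ⟩ := ih hb
    refine ⟨a • volumeElement R e k + ExteriorAlgebra.ι R (e k) * (-β), ?_, ?_⟩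
    · rw [mem_wedgeSpan_succ]
      push_cast
      rw [add_sub_cancel_right]
      exact ⟨_, Submodule.smul_mem _ a (volumeElement_mem k), _, neg_mem hβ, rfl⟩
    · have h0 : koszulVector e g k * (a • volumeElement R e k) = 0 := by
        have := koszulVector_mul_mem (g := g) (Submodule.smul_mem _ a (volumeElement_mem (e := e) k))
        rwa [wedgeSpan_eq_bot_of_lt (by omega), Submodule.mem_bot] at this
      rw [koszulVector_succ_mul, h0, mul_neg, hbβ, volumeElement, smul_smul, sub_neg_eq_add,
        ← add_smul, mul_smul_comm, zero_add]
      congr 1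
      ring

/-- Exactness of the Koszul cochain complex of a weakly regular sequence below the top degree. -/
theorem exists_eq_koszulVector_mul {n k : ℕ} (he : HasTriangularDual R e n) (hk : k ≤ n)
    (hg : ∀ j < k, ∀ c, c * g j ∈ initialIdeal g j → c ∈ initialIdeal g j)
    {d : ℤ} (hd : d ≠ k) {ω : ExteriorAlgebra R M} (hω : ω ∈ wedgeSpan e k d)
    (h : koszulVector e g k * ω = 0) :
    ∃ η ∈ wedgeSpan e k (d - 1), ω = koszulVector e g k * η := by
  induction k generalizing d ω with
  | zero =>
    have hd' : d ≠ 0 := by simpa using hd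
    simp only [wedgeSpan, if_neg hd', Submodule.mem_bot] at hω
    exact ⟨0, zero_mem _, by simp [hω]⟩
  | succ k ih =>
    have ih' := fun {d : ℤ} (hd : d ≠ k) {ω : ExteriorAlgebra R M} => ih (by omega)
      (fun j hj => hg j (by omega)) hd (ω := ω)
    push_cast at hd
    obtain ⟨α, hα, β, hβ, rfl⟩ := mem_wedgeSpan_succ.1 hω
    rw [koszulVector_succ_mul] at h
    have hβ' := koszulVector_mul_mem (g := g) hβ
    rw [sub_add_cancel] at hβ'
    obtain ⟨h1, h2⟩ := wedgeSpan_decomposition_unique he hk (koszulVector_mul_mem hα)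
      (sub_mem (Submodule.smul_mem _ (g k) hα) hβ') h
    have key : ∃ η ∈ wedgeSpan e k (d - 1), α = koszulVector e g k * η := by
      by_cases hdk : d = k
      · subst hdk
        rw [wedgeSpan_self, Submodule.mem_span_singleton] at hα
        obtain ⟨a, rfl⟩ := hα
        obtain ⟨c, hc, hcβ⟩ := koszulVector_mul_mem_top (g := g) hβ
        rw [hcβ, smul_smul, ← sub_smul] at h2
        have h3 := smul_volumeElement_eq_zero he (by omega) h2
        have ha : a ∈ initialIdeal g k := by
          refine hg k (by omega) a ?_
          rw [mul_comm, sub_eq_zero.1 h3]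
          exact hc
        obtain ⟨η, hη, hηa⟩ := exists_koszulVector_mul_eq_smul_volumeElement (e := e) ha
        exact ⟨η, hη, hηa.symm⟩
      · exact ih' hdk hα h1
    obtain ⟨α', hα', rfl⟩ := key
    have h3 : koszulVector e g k * (β - g k • α') = 0 := by
      rw [mul_sub, mul_smul_comm, ← neg_sub, h2, neg_zero]
    obtain ⟨β', hβ', hβ''⟩ := ih' (d := d - 1) (by omega)
      (sub_mem hβ (Submodule.smul_mem _ (g k) hα')) h3
    refine ⟨α' + ExteriorAlgebra.ι R (e k) * (-β'),
      mem_wedgeSpan_succ.2 ⟨_, hα', _, neg_mem hβ', rfl⟩, ?_⟩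
    rw [koszulVector_succ_mul, mul_neg, ← hβ'']
    congr 2
    abel

end KoszulCochain

section Filtration

variable {σ F : Type*} [Field F]

/-- The space of polynomials all of whose monomials have degree less than `m`. -/
noncomputable def degreeLTSubmodule (σ F : Type*) [Field F] (m : ℕ) :
    Submodule F (MvPolynomial σ F) :=
  restrictSupport F {s | s.degree < m}

theorem mem_degreeLTSubmodule {m : ℕ} {p : MvPolynomial σ F} :
    p ∈ degreeLTSubmodule σ F m ↔ ∀ s, m ≤ s.degree → coeff s p = 0 := by
  rw [degreeLTSubmodule, mem_restrictSupport_iff]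
  constructor
  · intro h s hs
    by_contra hc
    exact absurd (h (mem_support_iff.2 hc)) (not_lt.2 hs)
  · intro h s hs
    by_contra hc
    exact mem_support_iff.1 hs (h s (not_lt.1 hc))

theorem degreeLTSubmodule_mono {m m' : ℕ} (h : m ≤ m') :
    degreeLTSubmodule σ F m ≤ degreeLTSubmodule σ F m' :=
  restrictSupport_mono F fun _ hs => lt_of_lt_of_le hs h

theorem degreeLTSubmodule_zero : degreeLTSubmodule σ F 0 = ⊥ := by
  refine eq_bot_iff.2 fun p hp => ?_
  rw [mem_degreeLTSubmodule] at hp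
  exact MvPolynomial.ext _ _ fun s => by simpa using hp s (Nat.zero_le _)

theorem mem_degreeLTSubmodule_totalDegree (p : MvPolynomial σ F) :
    p ∈ degreeLTSubmodule σ F (p.totalDegree + 1) := by
  rw [mem_degreeLTSubmodule]
  intro s hs
  by_contra hc
  have := le_totalDegree (mem_support_iff.2 hc)
  rw [Finsupp.degree_apply] at hs
  simp only [Finsupp.sum] at this
  omega

theorem homogeneousComponent_mem_degreeLTSubmodule (m : ℕ) (p : MvPolynomial σ F) :
    homogeneousComponent m p ∈ degreeLTSubmodule σ F (m + 1) := by
  rw [mem_degreeLTSubmodule]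
  intro s hs
  rw [coeff_homogeneousComponent, if_neg (by omega)]

theorem homogeneousComponent_eq_zero_of_mem_degreeLTSubmodule {m : ℕ} {p : MvPolynomial σ F}
    (hp : p ∈ degreeLTSubmodule σ F m) : homogeneousComponent m p = 0 := by
  rw [mem_degreeLTSubmodule] at hp
  refine MvPolynomial.ext _ _ fun s => ?_
  rw [coeff_homogeneousComponent, coeff_zero]
  split_ifs with h
  · exact hp s h.ge
  · rfl

theorem sub_mem_degreeLTSubmodule {m : ℕ} {p q : MvPolynomial σ F}
    (hp : p ∈ degreeLTSubmodule σ F (m + 1)) (hq : q ∈ degreeLTSubmodule σ F (m + 1))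
    (h : homogeneousComponent m p = homogeneousComponent m q) :
    p - q ∈ degreeLTSubmodule σ F m := by
  rw [mem_degreeLTSubmodule] at *
  intro s hs
  rw [coeff_sub]
  rcases hs.eq_or_lt with h' | h'
  · have := congrArg (coeff s) h
    rw [coeff_homogeneousComponent, coeff_homogeneousComponent, if_pos h'.symm,
      if_pos h'.symm] at this
    rw [this, sub_self]
  · rw [hp s h', hq s h', sub_zero]

theorem mul_mem_degreeLTSubmodule {m m' : ℕ} {p q : MvPolynomial σ F}
    (hp : p ∈ degreeLTSubmodule σ F m) (hq : q ∈ degreeLTSubmodule σ F (m' + 1)) :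
    p * q ∈ degreeLTSubmodule σ F (m + m') := by
  classical
  rw [mem_degreeLTSubmodule] at *
  intro s hs
  rw [coeff_mul]
  refine Finset.sum_eq_zero fun x hx => ?_
  have hx' := congrArg Finsupp.degree (Finset.HasAntidiagonal.mem_antidiagonal.1 hx)
  rw [map_add] at hx'
  by_cases h : m ≤ x.1.degree
  · rw [hp _ h, zero_mul]
  · rw [hq x.2 (by omega), mul_zero]

theorem homogeneousComponent_mul_of_mem {m m' : ℕ} {p q : MvPolynomial σ F}
    (hp : p ∈ degreeLTSubmodule σ F (m + 1)) (hq : q ∈ degreeLTSubmodule σ F (m' + 1)) :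
    homogeneousComponent (m + m') (p * q) =
      homogeneousComponent m p * homogeneousComponent m' q := by
  classical
  rw [mem_degreeLTSubmodule] at *
  refine MvPolynomial.ext _ _ fun s => ?_
  rw [coeff_homogeneousComponent, coeff_mul, coeff_mul]
  simp only [coeff_homogeneousComponent]
  split_ifs with hs
  all_goals
    first
    | refine Finset.sum_congr rfl fun x hx => ?_
    | refine (Finset.sum_eq_zero fun x hx => ?_).symm
    have hx' := congrArg Finsupp.degree (Finset.HasAntidiagonal.mem_antidiagonal.1 hx)
    rw [map_add] at hx'
    split_ifs with h1 h2
  · rfl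
  · omega
  · rcases lt_or_gt_of_ne h1 with h | h
    · simp [hq x.2 (by omega)]
    · simp [hp x.1 (by omega)]
  · rcases lt_or_gt_of_ne h1 with h | h
    · simp [hq x.2 (by omega)]
    · simp [hp x.1 (by omega)]
  · omega
  · simp
  · simp
  · simp

theorem homogeneousComponent_mul_of_isHomogeneous {D d : ℕ} (r : MvPolynomial σ F)
    {h : MvPolynomial σ F} (hh : h.IsHomogeneous d) :
    homogeneousComponent D (r * h) = if d ≤ D then homogeneousComponent (D - d) r * h else 0 := by
  classical
  refine MvPolynomial.ext _ _ fun s => ?_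
  rw [apply_ite (coeff s), coeff_homogeneousComponent, coeff_mul, coeff_mul]
  simp only [coeff_homogeneousComponent, coeff_zero]
  have key : ∀ x ∈ Finset.HasAntidiagonal.antidiagonal s, x.2.degree ≠ d ∨
      x.1.degree + d = s.degree := by
    intro x hx
    have hx' := congrArg Finsupp.degree (Finset.HasAntidiagonal.mem_antidiagonal.1 hx)
    rw [map_add] at hx'
    omega
  split_ifs with h1 h2 h2
  · refine Finset.sum_congr rfl fun x hx => ?_
    rcases key x hx with h | h
    · rw [hh.coeff_eq_zero h]; simp
    · rw [if_pos (by omega)]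
  · refine Finset.sum_eq_zero fun x hx => ?_
    rcases key x hx with h | h
    · rw [hh.coeff_eq_zero h]; simp
    · omega
  · refine (Finset.sum_eq_zero fun x hx => ?_).symm
    rcases key x hx with h | h
    · rw [hh.coeff_eq_zero h]; simp
    · rw [if_neg (by omega), zero_mul]
  · rfl

/-- The ideal generated by the degree `d` components of `g 0, …, g (k - 1)`. -/
noncomputable def leadingIdeal (d : ℕ) (g : ℕ → MvPolynomial σ F) (k : ℕ) :
    Ideal (MvPolynomial σ F) :=
  initialIdeal (fun j => homogeneousComponent d (g j)) k

variable {g : ℕ → MvPolynomial σ F} {d : ℕ}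

theorem exists_lift_of_mem_leadingIdeal {k : ℕ} (hg : ∀ j < k, g j ∈ degreeLTSubmodule σ F (d + 1))
    {u : MvPolynomial σ F} (hu : u ∈ leadingIdeal d g k) (D : ℕ) :
    ∃ v ∈ initialIdeal g k, v ∈ degreeLTSubmodule σ F (D + 1) ∧
      homogeneousComponent D v = homogeneousComponent D u := by
  induction k generalizing u with
  | zero =>
    simp only [leadingIdeal, initialIdeal, Ideal.mem_bot] at hu
    exact ⟨0, zero_mem _, zero_mem _, by rw [hu]⟩
  | succ k ih =>
    obtain ⟨b, hb, r, rfl⟩ := mem_initialIdeal_succ.1 hu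
    obtain ⟨v, hv, hvD, hvb⟩ := ih (fun j hj => hg j (by omega)) hb
    have hh := homogeneousComponent_isHomogeneous d (g k)
    rw [map_add, homogeneousComponent_mul_of_isHomogeneous r hh, ← hvb]
    split_ifs with h
    · have hr := homogeneousComponent_mem_degreeLTSubmodule (D - d) r
      have hgk := hg k (by omega)
      refine ⟨v + homogeneousComponent (D - d) r * g k, mem_initialIdeal_succ.2 ⟨v, hv, _, rfl⟩,
        add_mem hvD ?_, ?_⟩
      · have := mul_mem_degreeLTSubmodule hr hgk
        rwa [show D - d + 1 + d = D + 1 by omega] at this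
      · have := homogeneousComponent_mul_of_mem hr hgk
        rw [Nat.sub_add_cancel h] at this
        rw [map_add, this, homogeneousComponent_of_mem (homogeneousComponent_mem _ _), if_pos rfl]
    · exact ⟨v, initialIdeal_le_succ g k hv, hvD, by rw [add_zero]⟩

/-- Elements of the ideal `(g 0, …, g (k - 1))` have leading forms in `leadingIdeal d g k`. -/
def HasLeadingIdeal (d : ℕ) (g : ℕ → MvPolynomial σ F) (k : ℕ) : Prop :=
  ∀ m, ∀ a ∈ initialIdeal g k, a ∈ degreeLTSubmodule σ F (m + 1) →
    homogeneousComponent m a ∈ leadingIdeal d g k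

theorem exists_eq_add_mul_of_mem {k : ℕ}
    (hg : ∀ j < k + 1, g j ∈ degreeLTSubmodule σ F (d + 1))
    (hreg : ∀ c, c * homogeneousComponent d (g k) ∈ leadingIdeal d g k → c ∈ leadingIdeal d g k)
    (hk : HasLeadingIdeal d g k) {m : ℕ} {a : MvPolynomial σ F}
    (ha : a ∈ initialIdeal g (k + 1)) (ham : a ∈ degreeLTSubmodule σ F m) :
    ∃ b ∈ initialIdeal g k, b ∈ degreeLTSubmodule σ F m ∧
      ∃ c ∈ degreeLTSubmodule σ F (m - d), a = b + c * g k := by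
  obtain ⟨b, hb, c, rfl⟩ := mem_initialIdeal_succ.1 ha
  have hgk := hg k (by omega)
  obtain ⟨D, hD⟩ : ∃ D, c ∈ degreeLTSubmodule σ F D := ⟨_, mem_degreeLTSubmodule_totalDegree c⟩
  induction D generalizing b c with
  | zero =>
    rw [degreeLTSubmodule_zero, Submodule.mem_bot] at hD
    subst hD
    exact ⟨b, hb, by simpa using ham, 0, zero_mem _, rfl⟩
  | succ D ih =>
    by_cases hDm : D + 1 ≤ m - d
    · refine ⟨b, hb, ?_, c, degreeLTSubmodule_mono hDm hD, rfl⟩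
      have := sub_mem ham (degreeLTSubmodule_mono (show D + 1 + d ≤ m by omega)
        (mul_mem_degreeLTSubmodule hD hgk))
      rwa [add_sub_cancel_right] at this
    · have ham' : b + c * g k ∈ degreeLTSubmodule σ F (D + d) :=
        degreeLTSubmodule_mono (by omega) ham
      have hcg := mul_mem_degreeLTSubmodule hD hgk
      rw [show D + 1 + d = D + d + 1 by omega] at hcg
      have hbm := sub_mem (degreeLTSubmodule_mono (Nat.le_succ _) ham') hcg
      rw [add_sub_cancel_right] at hbm
      have h1 := hk _ b hb hbm
      have h2 := homogeneousComponent_eq_zero_of_mem_degreeLTSubmodule ham'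
      rw [map_add, homogeneousComponent_mul_of_mem hD hgk] at h2
      have h3 : homogeneousComponent D c ∈ leadingIdeal d g k := by
        refine hreg _ ?_
        rw [eq_neg_of_add_eq_zero_right h2]
        exact neg_mem h1
      obtain ⟨v, hv, hvD, hvc⟩ := exists_lift_of_mem_leadingIdeal (fun j hj => hg j (by omega)) h3 D
      rw [homogeneousComponent_of_mem (homogeneousComponent_mem _ _), if_pos rfl] at hvc
      have h4 : b + c * g k = (b + v * g k) + (c - v) * g k := by ring
      rw [h4] at ha ham ⊢
      exact ih _ (add_mem hb (Ideal.mul_mem_right _ _ hv)) _ ha ham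
        (sub_mem_degreeLTSubmodule hD hvD hvc.symm)

theorem HasLeadingIdeal.succ {k : ℕ}
    (hg : ∀ j < k + 1, g j ∈ degreeLTSubmodule σ F (d + 1))
    (hreg : ∀ c, c * homogeneousComponent d (g k) ∈ leadingIdeal d g k → c ∈ leadingIdeal d g k)
    (hk : HasLeadingIdeal d g k) : HasLeadingIdeal d g (k + 1) := by
  intro m a ha ham
  obtain ⟨b, hb, hbm, c, hc, rfl⟩ := exists_eq_add_mul_of_mem hg hreg hk ha ham
  have h1 := hk m b hb hbm
  rw [map_add]
  by_cases h : d ≤ m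
  · rw [show m + 1 - d = m - d + 1 by omega] at hc
    have := homogeneousComponent_mul_of_mem hc (hg k (by omega))
    rw [Nat.sub_add_cancel h] at this
    exact mem_initialIdeal_succ.2 ⟨_, h1, _, by rw [this]⟩
  · rw [show m + 1 - d = 0 by omega, degreeLTSubmodule_zero, Submodule.mem_bot] at hc
    subst hc
    rw [zero_mul, map_zero, add_zero]
    exact initialIdeal_le_succ _ k h1

theorem hasLeadingIdeal {n : ℕ} (hg : ∀ j < n, g j ∈ degreeLTSubmodule σ F (d + 1))
    (hreg : ∀ j < n, ∀ c, c * homogeneousComponent d (g j) ∈ leadingIdeal d g j →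
      c ∈ leadingIdeal d g j) {k : ℕ} (hk : k ≤ n) : HasLeadingIdeal d g k := by
  induction k with
  | zero =>
    intro m a ha _
    simp only [initialIdeal, Ideal.mem_bot] at ha
    simp [ha]
  | succ k ih =>
    exact (ih (by omega)).succ (fun j hj => hg j (by omega)) (hreg k (by omega))

/-- A sequence whose leading forms are weakly regular is itself weakly regular. -/
theorem mem_initialIdeal_of_mul_mem {k : ℕ}
    (hg : ∀ j < k + 1, g j ∈ degreeLTSubmodule σ F (d + 1))
    (hreg : ∀ c, c * homogeneousComponent d (g k) ∈ leadingIdeal d g k → c ∈ leadingIdeal d g k)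
    (hk : HasLeadingIdeal d g k) {c : MvPolynomial σ F} (hc : c * g k ∈ initialIdeal g k) :
    c ∈ initialIdeal g k := by
  have hgk := hg k (by omega)
  obtain ⟨D, hD⟩ : ∃ D, c ∈ degreeLTSubmodule σ F D := ⟨_, mem_degreeLTSubmodule_totalDegree c⟩
  induction D generalizing c with
  | zero =>
    rw [degreeLTSubmodule_zero, Submodule.mem_bot] at hD
    rw [hD]
    exact zero_mem _
  | succ D ih =>
    have hcg := mul_mem_degreeLTSubmodule hD hgk
    rw [show D + 1 + d = D + d + 1 by omega] at hcg
    have h1 := hk _ _ hc hcg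
    rw [homogeneousComponent_mul_of_mem hD hgk] at h1
    obtain ⟨v, hv, hvD, hvc⟩ :=
      exists_lift_of_mem_leadingIdeal (fun j hj => hg j (by omega)) (hreg _ h1) D
    rw [homogeneousComponent_of_mem (homogeneousComponent_mem _ _), if_pos rfl] at hvc
    have h2 := ih (c := c - v) (by
      rw [sub_mul]
      exact sub_mem hc (Ideal.mul_mem_right _ _ hv)) (sub_mem_degreeLTSubmodule hD hvD hvc.symm)
    simpa using add_mem h2 hv

end Filtration

section HilbertFunction

variable {σ F : Type*} [Field F]

theorem finite_setOf_degree_lt [Finite σ] (m : ℕ) : {s : σ →₀ ℕ | s.degree < m}.Finite := by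
  classical
  have := Fintype.ofFinite σ
  refine ((Finset.range m).biUnion (Finset.finsuppAntidiag Finset.univ)).finite_toSet.subset ?_
  intro s hs
  simpa [Finset.mem_finsuppAntidiag, Finsupp.degree_eq_sum] using hs

instance finite_degreeLTSubmodule [Finite σ] (m : ℕ) :
    Module.Finite F (degreeLTSubmodule σ F m) := by
  have : Finite {s : σ →₀ ℕ | s.degree < m} := finite_setOf_degree_lt m
  exact Module.Finite.of_basis (basisRestrictSupport F {s : σ →₀ ℕ | s.degree < m})

theorem finrank_degreeLTSubmodule [Fintype σ] [DecidableEq σ] (m : ℕ) :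
    Module.finrank F (degreeLTSubmodule σ F m) =
      ∑ j ∈ Finset.range m, (Finset.finsuppAntidiag (Finset.univ : Finset σ) j).card := by
  rw [show Module.finrank F (degreeLTSubmodule σ F m) = _ from
      Module.finrank_eq_nat_card_basis (basisRestrictSupport F {s : σ →₀ ℕ | s.degree < m}),
    ← Finset.card_biUnion]
  · rw [← Set.ncard_coe_finset, ← Nat.card_coe_set_eq]
    congr 1
    have : {s : σ →₀ ℕ | s.degree < m} =
        ((Finset.range m).biUnion (Finset.finsuppAntidiag Finset.univ) : Finset (σ →₀ ℕ)) := by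
      ext s
      simp [Finset.mem_finsuppAntidiag, Finsupp.degree_eq_sum]
    rw [this]
  · intro i _ j _ hij
    rw [Function.onFun, Finset.disjoint_left]
    intro s hs hs'
    exact hij ((Finset.mem_finsuppAntidiag.1 hs).1.symm.trans (Finset.mem_finsuppAntidiag.1 hs').1)

theorem mk_finrank_degreeLTSubmodule (σ F : Type*) [Field F] [Fintype σ] :
    (PowerSeries.mk fun m => (Module.finrank F (degreeLTSubmodule σ F m) : ℤ)) =
      (PowerSeries.mk 1) ^ Fintype.card σ * PowerSeries.mk 1 * PowerSeries.X := by
  classical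
  have h : (PowerSeries.mk (1 : ℕ → ℤ)) ^ Fintype.card σ = PowerSeries.mk fun j =>
      ((Finset.finsuppAntidiag (Finset.univ : Finset σ) j).card : ℤ) := by
    ext j
    rw [← Finset.card_univ, ← Finset.prod_const, PowerSeries.coeff_prod]
    simp
  ext m
  cases m with
  | zero => simp [finrank_degreeLTSubmodule]
  | succ m =>
    rw [PowerSeries.coeff_succ_mul_X, h, PowerSeries.coeff_mul, PowerSeries.coeff_mk,
      finrank_degreeLTSubmodule, Finset.Nat.sum_antidiagonal_eq_sum_range_succ_mk]
    simp

/-- The elements of the ideal `(g 0, …, g (k - 1))` all of whose monomials have degree less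
than `m`. -/
noncomputable def idealDegreeLT (g : ℕ → MvPolynomial σ F) (k m : ℕ) :
    Submodule F (MvPolynomial σ F) :=
  (initialIdeal g k).restrictScalars F ⊓ degreeLTSubmodule σ F m

instance finite_idealDegreeLT [Finite σ] (g : ℕ → MvPolynomial σ F) (k m : ℕ) :
    Module.Finite F (idealDegreeLT g k m) :=
  Submodule.finiteDimensional_of_le (inf_le_right : _ ≤ degreeLTSubmodule σ F m)

variable {g : ℕ → MvPolynomial σ F} {d : ℕ}

theorem mem_idealDegreeLT {k m : ℕ} {p : MvPolynomial σ F} :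
    p ∈ idealDegreeLT g k m ↔ p ∈ initialIdeal g k ∧ p ∈ degreeLTSubmodule σ F m :=
  Iff.rfl

theorem mul_mem_degreeLTSubmodule_of_tsub {m d : ℕ} {c q : MvPolynomial σ F}
    (hc : c ∈ degreeLTSubmodule σ F (m - d)) (hq : q ∈ degreeLTSubmodule σ F (d + 1)) :
    c * q ∈ degreeLTSubmodule σ F m := by
  by_cases h : d ≤ m
  · have := mul_mem_degreeLTSubmodule hc hq
    rwa [Nat.sub_add_cancel h] at this
  · rw [show m - d = 0 by omega, degreeLTSubmodule_zero, Submodule.mem_bot] at hc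
    simp [hc]

theorem finrank_idealDegreeLT_succ [Finite σ] {k : ℕ}
    (hg : ∀ j < k + 1, g j ∈ degreeLTSubmodule σ F (d + 1))
    (hreg : ∀ c, c * homogeneousComponent d (g k) ∈ leadingIdeal d g k → c ∈ leadingIdeal d g k)
    (hk : HasLeadingIdeal d g k) (m : ℕ) :
    Module.finrank F (idealDegreeLT g (k + 1) m) + Module.finrank F (idealDegreeLT g k (m - d)) =
      Module.finrank F (idealDegreeLT g k m) +
        Module.finrank F (degreeLTSubmodule σ F (m - d)) := by
  let φ : (idealDegreeLT g k m × degreeLTSubmodule σ F (m - d)) →ₗ[F] MvPolynomial σ F :=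
    (idealDegreeLT g k m).subtype.coprod
      ((LinearMap.mulRight F (g k)).comp (degreeLTSubmodule σ F (m - d)).subtype)
  have hφ : ∀ x, φ x = (x.1 : MvPolynomial σ F) + x.2 * g k := fun x => rfl
  have hgk := hg k (by omega)
  have hrange : LinearMap.range φ = idealDegreeLT g (k + 1) m := by
    ext a
    rw [LinearMap.mem_range, mem_idealDegreeLT]
    constructor
    · rintro ⟨⟨b, c⟩, rfl⟩
      exact ⟨mem_initialIdeal_succ.2 ⟨b, b.2.1, c, rfl⟩,
        add_mem b.2.2 (mul_mem_degreeLTSubmodule_of_tsub c.2 hgk)⟩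
    · rintro ⟨ha, ham⟩
      obtain ⟨b, hb, hbm, c, hc, rfl⟩ := exists_eq_add_mul_of_mem hg hreg hk ha ham
      exact ⟨⟨⟨b, hb, hbm⟩, ⟨c, hc⟩⟩, rfl⟩
  let ψ : LinearMap.ker φ →ₗ[F] MvPolynomial σ F :=
    (degreeLTSubmodule σ F (m - d)).subtype.comp
      ((LinearMap.snd F _ _).comp (LinearMap.ker φ).subtype)
  have hψ : ∀ x, ψ x = (x.1.2 : MvPolynomial σ F) := fun x => rfl
  have hψinj : Function.Injective ψ := by
    rintro ⟨⟨b, c⟩, hx⟩ ⟨⟨b', c'⟩, hy⟩ h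
    rw [LinearMap.mem_ker, hφ] at hx hy
    rw [hψ, hψ] at h
    simp only at h hx hy
    rw [h, ← hy] at hx
    ext1
    exact Prod.ext (Subtype.ext (add_right_cancel hx)) (Subtype.ext h)
  have hψrange : LinearMap.range ψ = idealDegreeLT g k (m - d) := by
    ext a
    rw [LinearMap.mem_range, mem_idealDegreeLT]
    constructor
    · rintro ⟨⟨⟨b, c⟩, hbc⟩, rfl⟩
      rw [LinearMap.mem_ker, hφ] at hbc
      refine ⟨mem_initialIdeal_of_mul_mem hg hreg hk ?_, c.2⟩
      rw [hψ]
      simp only at hbc ⊢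
      rw [eq_neg_of_add_eq_zero_right hbc]
      exact neg_mem b.2.1
    · rintro ⟨ha, ham⟩
      refine ⟨⟨⟨⟨-(a * g k), neg_mem (Ideal.mul_mem_right _ _ ha),
        neg_mem (mul_mem_degreeLTSubmodule_of_tsub ham hgk)⟩, ⟨a, ham⟩⟩, ?_⟩, rfl⟩
      rw [LinearMap.mem_ker, hφ]
      simp
  have h1 := LinearMap.finrank_range_add_finrank_ker φ
  rw [Module.finrank_prod, hrange] at h1
  rw [← h1, ← hψrange, LinearMap.finrank_range_of_inj hψinj]

/-- The (affine) Hilbert function of the ideal `(g 0, …, g (k - 1))`. -/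
noncomputable def hilbertFunction (g : ℕ → MvPolynomial σ F) (k m : ℕ) : ℤ :=
  Module.finrank F (degreeLTSubmodule σ F m) - Module.finrank F (idealDegreeLT g k m)

theorem mk_hilbertFunction_succ [Finite σ] {k : ℕ}
    (hg : ∀ j < k + 1, g j ∈ degreeLTSubmodule σ F (d + 1))
    (hreg : ∀ c, c * homogeneousComponent d (g k) ∈ leadingIdeal d g k → c ∈ leadingIdeal d g k)
    (hk : HasLeadingIdeal d g k) :
    PowerSeries.mk (hilbertFunction g (k + 1)) =
      PowerSeries.mk (hilbertFunction g k) * (1 - PowerSeries.X ^ d) := by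
  ext m
  have h := finrank_idealDegreeLT_succ hg hreg hk m
  have h0 : Module.finrank F (degreeLTSubmodule σ F 0) = 0 := by
    rw [degreeLTSubmodule_zero, finrank_bot]
  have h0' : Module.finrank F (idealDegreeLT g k 0) = 0 := by
    rw [idealDegreeLT, degreeLTSubmodule_zero, inf_bot_eq, finrank_bot]
  rw [mul_sub, mul_one, map_sub, PowerSeries.coeff_mul_X_pow', PowerSeries.coeff_mk,
    PowerSeries.coeff_mk, PowerSeries.coeff_mk]
  simp only [hilbertFunction]
  split_ifs with hm
  · omega
  · rw [show m - d = 0 by omega, h0, h0'] at h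
    omega

theorem mk_hilbertFunction [Fintype σ] {n : ℕ}
    (hg : ∀ j < n, g j ∈ degreeLTSubmodule σ F (d + 1))
    (hreg : ∀ j < n, ∀ c, c * homogeneousComponent d (g j) ∈ leadingIdeal d g j →
      c ∈ leadingIdeal d g j) {k : ℕ} (hk : k ≤ n) :
    PowerSeries.mk (hilbertFunction g k) =
      (PowerSeries.mk 1) ^ Fintype.card σ * PowerSeries.mk 1 * PowerSeries.X *
        (1 - PowerSeries.X ^ d) ^ k := by
  induction k with
  | zero =>
    rw [pow_zero, mul_one, ← mk_finrank_degreeLTSubmodule σ F]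
    congr 1
    ext m
    have h0 : idealDegreeLT g 0 m = ⊥ :=
      eq_bot_iff.2 fun p hp => by simpa [initialIdeal] using (mem_idealDegreeLT.1 hp).1
    simp [hilbertFunction, h0]
  | succ k ih =>
    rw [mk_hilbertFunction_succ (fun j hj => hg j (by omega)) (hreg k (by omega))
      (hasLeadingIdeal hg hreg (by omega)), ih (by omega), pow_succ, mul_assoc]

theorem exists_hilbertFunction_eq [Fintype σ]
    (hg : ∀ j < Fintype.card σ, g j ∈ degreeLTSubmodule σ F (d + 1))
    (hreg : ∀ j < Fintype.card σ, ∀ c, c * homogeneousComponent d (g j) ∈ leadingIdeal d g j →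
      c ∈ leadingIdeal d g j) :
    ∃ M, ∀ m ≥ M, hilbertFunction g (Fintype.card σ) m = (d : ℤ) ^ Fintype.card σ := by
  let P : Polynomial ℤ :=
    Polynomial.X * (∑ i ∈ Finset.range d, Polynomial.X ^ i) ^ Fintype.card σ
  have hP : P.eval 1 = (d : ℤ) ^ Fintype.card σ := by
    simp [P, Polynomial.eval_finsetSum]
  have hgeom : (PowerSeries.mk (1 : ℕ → ℤ)) * (1 - PowerSeries.X ^ d) =
      ∑ i ∈ Finset.range d, PowerSeries.X ^ i := by
    rw [← geom_sum_mul_neg, mul_comm, mul_assoc, mul_comm (1 - PowerSeries.X),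
      PowerSeries.mk_one_mul_one_sub_eq_one, mul_one]
  have hseries : PowerSeries.mk (hilbertFunction g (Fintype.card σ)) =
      (P : PowerSeries ℤ) * PowerSeries.mk 1 := by
    rw [mk_hilbertFunction hg hreg le_rfl]
    have : (P : PowerSeries ℤ) = PowerSeries.X *
        (PowerSeries.mk (1 : ℕ → ℤ) * (1 - PowerSeries.X ^ d)) ^ Fintype.card σ := by
      rw [hgeom]
      simp only [P, Polynomial.coe_mul, Polynomial.coe_pow, Polynomial.coe_X]
      congr 2
      rw [← Polynomial.coeToPowerSeries.ringHom_apply, map_sum]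
      simp
    rw [this, mul_pow]
    ring
  refine ⟨P.natDegree, fun m hm => ?_⟩
  have := congrArg (PowerSeries.coeff m) hseries
  rw [PowerSeries.coeff_mk, PowerSeries.coeff_mul,
    Finset.Nat.sum_antidiagonal_eq_sum_range_succ_mk] at this
  rw [this, ← hP, Polynomial.eval_eq_sum_range' (Nat.lt_succ_of_le hm)]
  simp

theorem finrank_map_mkQ_degreeLTSubmodule [Finite σ] (k m : ℕ) :
    (Module.finrank F ((degreeLTSubmodule σ F m).map
      ((initialIdeal g k).restrictScalars F).mkQ) : ℤ) = hilbertFunction g k m := by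
  let φ := ((initialIdeal g k).restrictScalars F).mkQ.comp (degreeLTSubmodule σ F m).subtype
  have hrange : LinearMap.range φ =
      (degreeLTSubmodule σ F m).map ((initialIdeal g k).restrictScalars F).mkQ := by
    rw [LinearMap.range_comp, Submodule.range_subtype]
  have hker : Module.finrank F (LinearMap.ker φ) = Module.finrank F (idealDegreeLT g k m) := by
    rw [LinearMap.ker_comp, Submodule.ker_mkQ, ← Submodule.finrank_map_subtype_eq,
      Submodule.map_comap_subtype, inf_comm]
    rfl
  have h := LinearMap.finrank_range_add_finrank_ker φ
  rw [hrange, hker] at h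
  rw [hilbertFunction, ← h]
  push_cast
  ring

/-- Bézout: polynomials in `card σ` variables whose degree `d` forms are weakly regular define
a quotient of dimension `d ^ card σ`. -/
theorem finrank_quotient_initialIdeal [Fintype σ]
    (hg : ∀ j < Fintype.card σ, g j ∈ degreeLTSubmodule σ F (d + 1))
    (hreg : ∀ j < Fintype.card σ, ∀ c, c * homogeneousComponent d (g j) ∈ leadingIdeal d g j →
      c ∈ leadingIdeal d g j) :
    FiniteDimensional F (MvPolynomial σ F ⧸ initialIdeal g (Fintype.card σ)) ∧
      Module.finrank F (MvPolynomial σ F ⧸ initialIdeal g (Fintype.card σ)) =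
        d ^ Fintype.card σ := by
  obtain ⟨M, hM⟩ := exists_hilbertFunction_eq hg hreg
  let Q := fun m => (degreeLTSubmodule σ F m).map
    ((initialIdeal g (Fintype.card σ)).restrictScalars F).mkQ
  have hfin : ∀ m ≥ M, Module.finrank F (Q m) = d ^ Fintype.card σ := fun m hm => by
    have := finrank_map_mkQ_degreeLTSubmodule (g := g) (Fintype.card σ) m
    rw [hM m hm] at this
    exact_mod_cast this
  have hmono : ∀ m ≥ M, Q M = Q m := fun m hm =>
    Submodule.eq_of_le_of_finrank_eq (Submodule.map_mono (degreeLTSubmodule_mono hm))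
      ((hfin M le_rfl).trans (hfin m hm).symm)
  have htop : Q M = ⊤ := by
    refine eq_top_iff.2 fun x _ => ?_
    obtain ⟨p, rfl⟩ := Submodule.mkQ_surjective _ x
    rw [hmono (max M (p.totalDegree + 1)) (le_max_left _ _)]
    exact Submodule.mem_map_of_mem (degreeLTSubmodule_mono (le_max_right _ _)
      (mem_degreeLTSubmodule_totalDegree p))
  have hfd : Module.Finite F (⊤ : Submodule F (MvPolynomial σ F ⧸
      (initialIdeal g (Fintype.card σ)).restrictScalars F)) := by
    rw [← htop]
    infer_instance
  have h := hfin M le_rfl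
  rw [htop] at h
  have E : (⊤ : Submodule F (MvPolynomial σ F ⧸
      (initialIdeal g (Fintype.card σ)).restrictScalars F)) ≃ₗ[F]
      (MvPolynomial σ F ⧸ initialIdeal g (Fintype.card σ)) :=
    Submodule.topEquiv.trans (Submodule.Quotient.restrictScalarsEquiv F _)
  exact ⟨Module.Finite.equiv E, E.finrank_eq ▸ h⟩

end HilbertFunction

section PartialDerivatives

variable {F : Type} [Field F] {n : ℕ}

/-- A function on `Fin n`, extended by zero to a sequence. -/
def extendZero {A : Type*} [Zero A] (v : Fin n → A) (j : ℕ) : A :=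
  if h : j < n then v ⟨j, h⟩ else 0

theorem extendZero_of_lt {A : Type*} [Zero A] (v : Fin n → A) {j : ℕ} (h : j < n) :
    extendZero v j = v ⟨j, h⟩ :=
  dif_pos h

/-- The standard basis `dx_1, …, dx_n`, extended by zero to a sequence. -/
noncomputable def basisSeq (F : Type) [Field F] (n : ℕ) : ℕ → Fin n → PolyRing F n :=
  extendZero fun i => Pi.single i 1

/-- The partial derivatives of `f`, extended by zero to a sequence. -/
noncomputable def pderivSeq (f : PolyRing F n) : ℕ → PolyRing F n :=
  extendZero fun i => pderiv i f

theorem hasTriangularDual_basisSeq (F : Type) [Field F] (n : ℕ) :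
    HasTriangularDual (PolyRing F n) (basisSeq F n) n := by
  intro k hk
  refine ⟨LinearMap.proj ⟨k, hk⟩, ?_, fun j hj => ?_⟩
  · simp [basisSeq, extendZero_of_lt _ hk]
  · simp [basisSeq, extendZero_of_lt _ (hj.trans hk), hj.ne']

theorem dform_eq_koszulVector (f : PolyRing F n) :
    dform f = koszulVector (basisSeq F n) (pderivSeq f) n := by
  rw [dform, koszulVector, Finset.sum_range]
  congr 1
  ext1 j
  simp [basisSeq, pderivSeq, extendZero, Finset.sum_apply, Pi.single_apply]

theorem image_extendZero_Iio {A : Type*} [Zero A] (v : Fin n → A) {k : ℕ} (hk : k ≤ n) :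
    extendZero v '' Set.Iio k = {a | ∃ i : Fin n, (i : ℕ) < k ∧ v i = a} := by
  ext a
  constructor
  · rintro ⟨j, hj, rfl⟩
    exact ⟨⟨j, lt_of_lt_of_le hj hk⟩, hj, (extendZero_of_lt v _).symm⟩
  · rintro ⟨i, hi, rfl⟩
    exact ⟨i, hi, extendZero_of_lt v i.2⟩

theorem initialIdeal_pderivSeq (f : PolyRing F n) :
    initialIdeal (pderivSeq f) n = Ideal.span (Set.range fun j => pderiv j f) := by
  rw [initialIdeal_eq_span, pderivSeq, image_extendZero_Iio _ le_rfl]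
  congr 1
  ext a
  simp

theorem ofList_take_ofFn {A : Type*} [CommRing A] (v : Fin n → A) {k : ℕ} (hk : k ≤ n) :
    Ideal.ofList ((List.ofFn v).take k) = initialIdeal (extendZero v) k := by
  rw [initialIdeal_eq_span, image_extendZero_Iio v hk, Ideal.ofList]
  congr 1
  ext a
  rw [Set.mem_ofPred_eq, Set.mem_ofPred_eq, List.mem_take_iff_getElem]
  constructor
  · rintro ⟨i, hi, rfl⟩
    rw [List.length_ofFn, lt_min_iff] at hi
    exact ⟨⟨i, hi.2⟩, hi.1, by simp⟩
  · rintro ⟨i, hi, rfl⟩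
    exact ⟨i, by simp [hi], by simp⟩

theorem mem_of_mul_mem_initialIdeal {A : Type*} [CommRing A] {v : Fin n → A}
    (hv : RingTheory.Sequence.IsWeaklyRegular A (List.ofFn v)) {k : ℕ} (hk : k < n) {c : A}
    (hc : c * extendZero v k ∈ initialIdeal (extendZero v) k) :
    c ∈ initialIdeal (extendZero v) k := by
  have h := (RingTheory.Sequence.isWeaklyRegular_iff _ _).1 hv k (by simpa using hk)
  rw [isSMulRegular_quotient_iff_mem_of_smul_mem, ofList_take_ofFn v hk.le] at h
  have h' := h c
  rw [smul_eq_mul, Ideal.mul_top, smul_eq_mul, mul_comm, List.getElem_ofFn,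
    ← extendZero_of_lt v hk] at h'
  exact h' hc

theorem homogeneousComponent_pderiv (i : Fin n) (f : PolyRing F n) (δ : ℕ) (hf : f.totalDegree = δ) :
    homogeneousComponent (δ - 1) (pderiv i f) = pderiv i (homogeneousComponent δ f) := by
  ext s
  rw [coeff_homogeneousComponent, coeff_pderiv, coeff_pderiv, coeff_homogeneousComponent]
  have hs : (s + Finsupp.single i 1).degree = s.degree + 1 := by simp
  rw [hs]
  have h0 := mem_degreeLTSubmodule.1 (mem_degreeLTSubmodule_totalDegree f) (s + Finsupp.single i 1)
  rw [hs, hf] at h0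
  by_cases h : s.degree + 1 = δ
  · rw [if_pos h, if_pos (by omega)]
  · rw [if_neg h, zero_mul]
    split_ifs with h'
    · rw [h0 (by omega), zero_mul]
    · rfl

theorem pderiv_mem_degreeLTSubmodule (i : Fin n) {f : PolyRing F n} {δ : ℕ}
    (hf : f.totalDegree = δ) : pderiv i f ∈ degreeLTSubmodule (Fin n) F (δ - 1 + 1) := by
  rw [mem_degreeLTSubmodule]
  intro s hs
  rw [coeff_pderiv, mem_degreeLTSubmodule.1 (mem_degreeLTSubmodule_totalDegree f), zero_mul]
  rw [map_add, Finsupp.degree_single]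
  omega

theorem pderivSeq_mem_degreeLTSubmodule {f : PolyRing F n} {δ : ℕ} (hf : f.totalDegree = δ)
    {j : ℕ} (hj : j < n) : pderivSeq f j ∈ degreeLTSubmodule (Fin n) F (δ - 1 + 1) := by
  rw [pderivSeq, extendZero_of_lt _ hj]
  exact pderiv_mem_degreeLTSubmodule _ hf

theorem homogeneousComponent_pderivSeq {f : PolyRing F n} {δ : ℕ} (hf : f.totalDegree = δ) (j : ℕ) :
    homogeneousComponent (δ - 1) (pderivSeq f j) = pderivSeq (homogeneousComponent δ f) j := by
  rw [pderivSeq, pderivSeq, extendZero, extendZero]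
  split_ifs
  · exact homogeneousComponent_pderiv _ f δ hf
  · exact map_zero _

theorem mem_leadingIdeal_pderivSeq {f : PolyRing F n} {δ : ℕ} (hf : f.totalDegree = δ)
    (hreg : RingTheory.Sequence.IsWeaklyRegular (PolyRing F n)
      (List.ofFn fun j : Fin n => pderiv j (homogeneousComponent δ f)))
    {j : ℕ} (hj : j < n) {c : PolyRing F n}
    (hc : c * homogeneousComponent (δ - 1) (pderivSeq f j) ∈ leadingIdeal (δ - 1) (pderivSeq f) j) :
    c ∈ leadingIdeal (δ - 1) (pderivSeq f) j := by
  simp only [leadingIdeal, homogeneousComponent_pderivSeq hf] at hc ⊢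
  exact mem_of_mul_mem_initialIdeal hreg hj hc

theorem mem_initialIdeal_pderivSeq_of_mul_mem {f : PolyRing F n} {δ : ℕ} (hf : f.totalDegree = δ)
    (hreg : RingTheory.Sequence.IsWeaklyRegular (PolyRing F n)
      (List.ofFn fun j : Fin n => pderiv j (homogeneousComponent δ f)))
    {j : ℕ} (hj : j < n) {c : PolyRing F n}
    (hc : c * pderivSeq f j ∈ initialIdeal (pderivSeq f) j) : c ∈ initialIdeal (pderivSeq f) j :=
  mem_initialIdeal_of_mul_mem (d := δ - 1)
    (fun _ hi => pderivSeq_mem_degreeLTSubmodule hf (lt_of_lt_of_le hi hj))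
    (fun _ => mem_leadingIdeal_pderivSeq hf hreg hj)
    (hasLeadingIdeal (fun _ hi => pderivSeq_mem_degreeLTSubmodule hf hi)
      (fun _ hi _ => mem_leadingIdeal_pderivSeq hf hreg hi) hj.le) hc

theorem finrank_quotient_span_pderiv {f : PolyRing F n} {δ : ℕ} (hf : f.totalDegree = δ)
    (hreg : RingTheory.Sequence.IsWeaklyRegular (PolyRing F n)
      (List.ofFn fun j : Fin n => pderiv j (homogeneousComponent δ f))) :
    FiniteDimensional F (PolyRing F n ⧸ Ideal.span (Set.range fun j => pderiv j f)) ∧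
      Module.finrank F (PolyRing F n ⧸ Ideal.span (Set.range fun j => pderiv j f)) =
        (δ - 1) ^ n := by
  have h := finrank_quotient_initialIdeal (σ := Fin n) (g := pderivSeq f) (d := δ - 1)
  rw [Fintype.card_fin, initialIdeal_pderivSeq] at h
  exact h (fun _ hi => pderivSeq_mem_degreeLTSubmodule hf hi)
    (fun _ hi _ => mem_leadingIdeal_pderivSeq hf hreg hi)

end PartialDerivatives

section Forms

variable {F : Type} [Field F] {n : ℕ}

theorem wedgeMonomial_zero (s : Fin 0 → Fin n) (c : PolyRing F n) :
    wedgeMonomial 0 s c = c • 1 := by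
  simp [wedgeMonomial]

theorem wedgeMonomial_succ {k : ℕ} (s : Fin (k + 1) → Fin n) (c : PolyRing F n) :
    wedgeMonomial (k + 1) s c = ExteriorAlgebra.ι (PolyRing F n) (basisSeq F n (s 0)) *
      wedgeMonomial k (fun i => s i.succ) c := by
  simp [wedgeMonomial, basisSeq, extendZero, List.ofFn_succ]

theorem wedgeMonomial_mem_wedgeSpan {k : ℕ} (s : Fin k → Fin n) (c : PolyRing F n) :
    wedgeMonomial k s c ∈ wedgeSpan (R := PolyRing F n) (basisSeq F n) n k := by
  induction k with
  | zero =>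
    rw [wedgeMonomial_zero]
    refine Submodule.smul_mem _ _ ?_
    have : ∀ m, (1 : FormAlgebra F n) ∈ wedgeSpan (R := PolyRing F n) (basisSeq F n) m 0 := by
      intro m
      induction m with
      | zero => simp [wedgeSpan, Submodule.mem_span_singleton_self]
      | succ m ih => exact wedgeSpan_le_succ m 0 ih
    exact this n
  | succ k ih =>
    rw [wedgeMonomial_succ]
    exact_mod_cast ι_mul_mem_wedgeSpan (s 0).2 (ih _)

theorem IsForm.smul {k : ℕ} {ω : FormAlgebra F n} (hω : IsForm k ω) (c : PolyRing F n) :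
    IsForm k (c • ω) := by
  unfold IsForm at hω ⊢
  induction hω using AddSubgroup.closure_induction with
  | mem x hx =>
    obtain ⟨s, a, rfl⟩ := hx
    exact AddSubgroup.subset_closure ⟨s, c * a, by rw [wedgeMonomial, wedgeMonomial, smul_smul]⟩
  | zero => rw [smul_zero]; exact zero_mem _
  | add x y _ _ hx hy => rw [smul_add]; exact add_mem hx hy
  | neg x _ hx => rw [smul_neg]; exact neg_mem hx

theorem IsForm.ι_mul {k : ℕ} {ω : FormAlgebra F n} (hω : IsForm k ω) {j : ℕ} (hj : j < n) :
    IsForm (k + 1) (ExteriorAlgebra.ι (PolyRing F n) (basisSeq F n j) * ω) := by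
  unfold IsForm at hω ⊢
  induction hω using AddSubgroup.closure_induction with
  | mem x hx =>
    obtain ⟨s, a, rfl⟩ := hx
    refine AddSubgroup.subset_closure ⟨Fin.cons ⟨j, hj⟩ s, a, ?_⟩
    rw [wedgeMonomial_succ]
    simp
  | zero => rw [mul_zero]; exact zero_mem _
  | add x y _ _ hx hy => rw [mul_add]; exact add_mem hx hy
  | neg x _ hx => rw [mul_neg]; exact neg_mem hx

theorem isForm_of_mem_wedgeSpan {m : ℕ} (hm : m ≤ n) {k : ℕ} {ω : FormAlgebra F n}
    (hω : ω ∈ wedgeSpan (R := PolyRing F n) (basisSeq F n) m k) : IsForm k ω := by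
  induction m generalizing k ω with
  | zero =>
    rw [wedgeSpan] at hω
    split_ifs at hω with h
    · obtain rfl : k = 0 := by exact_mod_cast h
      obtain ⟨c, rfl⟩ := Submodule.mem_span_singleton.1 hω
      exact AddSubgroup.subset_closure ⟨Fin.elim0, c, (wedgeMonomial_zero _ c).symm⟩
    · rw [(Submodule.mem_bot _).1 hω]
      exact zero_mem _
  | succ m ih =>
    obtain ⟨α, hα, β, hβ, rfl⟩ := mem_wedgeSpan_succ.1 hω
    refine add_mem (ih (by omega) hα) ?_
    cases k with
    | zero =>
      rw [wedgeSpan_eq_bot_of_neg m (by simp), Submodule.mem_bot] at hβ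
      rw [hβ, mul_zero]
      exact zero_mem _
    | succ k =>
      refine IsForm.ι_mul (ih (by omega) ?_) hm
      simpa using hβ

theorem isForm_iff_mem_wedgeSpan {k : ℕ} {ω : FormAlgebra F n} :
    IsForm k ω ↔ ω ∈ wedgeSpan (R := PolyRing F n) (basisSeq F n) n k := by
  refine ⟨fun h => ?_, isForm_of_mem_wedgeSpan le_rfl⟩
  refine (AddSubgroup.closure_le (wedgeSpan (R := PolyRing F n) (basisSeq F n) n
    k).toAddSubgroup).2 ?_ h
  rintro _ ⟨s, c, rfl⟩
  exact wedgeMonomial_mem_wedgeSpan s c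

theorem exists_isForm_eq_dform_mul {f : PolyRing F n} {δ : ℕ} (hf : f.totalDegree = δ)
    (hreg : RingTheory.Sequence.IsWeaklyRegular (PolyRing F n)
      (List.ofFn fun j : Fin n => pderiv j (homogeneousComponent δ f)))
    {i : ℕ} (hi : i ≠ n) {ω : FormAlgebra F n} (hω : IsForm i ω) (h : dform f * ω = 0) :
    ∃ η : FormAlgebra F n, IsForm (i - 1) η ∧ ω = dform f * η := by
  rw [dform_eq_koszulVector] at h ⊢
  obtain ⟨η, hη, rfl⟩ := exists_eq_koszulVector_mul (hasTriangularDual_basisSeq F n) le_rfl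
    (fun j hj _ => mem_initialIdeal_pderivSeq_of_mul_mem hf hreg hj)
    (by exact_mod_cast hi) (isForm_iff_mem_wedgeSpan.1 hω) h
  refine ⟨η, ?_, rfl⟩
  cases i with
  | zero =>
    rw [wedgeSpan_eq_bot_of_neg n (by simp), Submodule.mem_bot] at hη
    rw [hη]
    exact zero_mem _
  | succ i =>
    rw [isForm_iff_mem_wedgeSpan]
    simpa using hη

theorem isForm_top_iff {ω : FormAlgebra F n} :
    IsForm n ω ↔ ∃ c : PolyRing F n, c • volumeElement (PolyRing F n) (basisSeq F n) n = ω := by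
  rw [isForm_iff_mem_wedgeSpan, wedgeSpan_self, Submodule.mem_span_singleton]

theorem mem_boundarySubspace {f : PolyRing F n} {k : ℕ} {ω : FormAlgebra F n} :
    ω ∈ boundarySubspace F n f k ↔ ∃ η, IsForm (k - 1) η ∧ ω = dform f * η := by
  refine ⟨fun h => ?_, fun h => Submodule.subset_span h⟩
  rw [boundarySubspace] at h
  induction h using Submodule.span_induction with
  | mem x hx => exact hx
  | zero => exact ⟨0, zero_mem _, (mul_zero _).symm⟩
  | add x y _ _ hx hy =>
    obtain ⟨η, hη, rfl⟩ := hx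
    obtain ⟨θ, hθ, rfl⟩ := hy
    exact ⟨η + θ, add_mem hη hθ, (mul_add _ _ _).symm⟩
  | smul a x _ hx =>
    obtain ⟨η, hη, rfl⟩ := hx
    exact ⟨algebraMap F (PolyRing F n) a • η, hη.smul _, (mul_smul_comm (algebraMap F (PolyRing F n) a) _ _).symm⟩

theorem smul_volumeElement_mem_boundarySubspace {f c : PolyRing F n} :
    c • volumeElement (PolyRing F n) (basisSeq F n) n ∈ boundarySubspace F n f n ↔
      c ∈ initialIdeal (pderivSeq f) n := by
  rw [mem_boundarySubspace, dform_eq_koszulVector]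
  have hinj : ∀ a b : PolyRing F n, a • volumeElement (PolyRing F n) (basisSeq F n) n =
      b • volumeElement (PolyRing F n) (basisSeq F n) n → a = b := fun a b h =>
    sub_eq_zero.1 (smul_volumeElement_eq_zero (hasTriangularDual_basisSeq F n) le_rfl
      (by rw [sub_smul, h, sub_self]))
  constructor
  · rintro ⟨η, hη, h⟩
    rcases Nat.eq_zero_or_pos n with rfl | hn
    · rw [koszulVector_zero, zero_mul] at h
      rw [hinj c 0 (by rw [h, zero_smul])]
      exact zero_mem _
    · rw [isForm_iff_mem_wedgeSpan, Nat.cast_sub hn, Nat.cast_one] at hη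
      obtain ⟨a, ha, h'⟩ := koszulVector_mul_mem_top (g := pderivSeq f) hη
      rwa [hinj c a (h.trans h')]
  · intro hc
    obtain ⟨η, hη, h⟩ := exists_koszulVector_mul_eq_smul_volumeElement (e := basisSeq F n) hc
    refine ⟨η, ?_, h.symm⟩
    rcases Nat.eq_zero_or_pos n with rfl | hn
    · rw [wedgeSpan_eq_bot_of_neg _ (by simp), Submodule.mem_bot] at hη
      rw [hη]
      exact zero_mem _
    · rwa [isForm_iff_mem_wedgeSpan, Nat.cast_sub hn, Nat.cast_one]

/-- The `F`-linear isomorphism `c ↦ c dx_n ∧ ⋯ ∧ dx_1` onto the top forms, followed by the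
projection to the top cohomology. -/
noncomputable def toTopCohomology (f : PolyRing F n) : PolyRing F n →ₗ[F] topCohomology F n f :=
  (Submodule.mkQ _).comp
    { toFun := fun c => ⟨c • volumeElement (PolyRing F n) (basisSeq F n) n,
        mem_formSubspace.2 (isForm_top_iff.2 ⟨c, rfl⟩)⟩
      map_add' := fun a b => Subtype.ext (add_smul a b _)
      map_smul' := fun a b => Subtype.ext <| show (a • b) • volumeElement (PolyRing F n) (basisSeq F n) n =
        algebraMap F (PolyRing F n) a • b • volumeElement (PolyRing F n) (basisSeq F n) n by
          rw [Algebra.smul_def a b, mul_smul] }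

theorem toTopCohomology_surjective (f : PolyRing F n) :
    Function.Surjective (toTopCohomology f) := by
  intro x
  obtain ⟨⟨ω, hω⟩, rfl⟩ := Submodule.mkQ_surjective _ x
  obtain ⟨c, rfl⟩ := isForm_top_iff.1 (mem_formSubspace.1 hω)
  exact ⟨c, rfl⟩

theorem ker_toTopCohomology (f : PolyRing F n) :
    LinearMap.ker (toTopCohomology f) =
      (Ideal.span (Set.range fun j => pderiv j f)).restrictScalars F := by
  ext c
  rw [LinearMap.mem_ker, Submodule.restrictScalars_mem, ← initialIdeal_pderivSeq,
    ← smul_volumeElement_mem_boundarySubspace]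
  exact Submodule.Quotient.mk_eq_zero _

/-- The top cohomology is the quotient of the polynomial ring by the Jacobian ideal. -/
noncomputable def quotientEquivTopCohomology (f : PolyRing F n) :
    (PolyRing F n ⧸ Ideal.span (Set.range fun j => pderiv j f)) ≃ₗ[F] topCohomology F n f :=
  (Submodule.Quotient.restrictScalarsEquiv F _).symm.trans <|
    (Submodule.quotEquivOfEq _ _ (ker_toTopCohomology f).symm).trans <|
      (toTopCohomology f).quotKerEquivOfSurjective (toTopCohomology_surjective f)

end Forms

/-- If the partial derivatives of the top homogeneous part `f^{(δ)}` form a regular sequence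
in `F[x_1,…,x_n]`, then `H^i(Ω^·, φ_f) = 0` for `i ≠ n`,
`dim_F F[x]/(∂f/∂x_1,…,∂f/∂x_n) = (δ-1)^n`, and in particular
`dim_F H^n(Ω^·, φ_f) = (δ-1)^n`. -/
theorem regular_sequence_cohomology
    {F : Type} [Field F] [Fintype F] {n : ℕ} (f : MvPolynomial (Fin n) F) (δ : ℕ)
    (hdeg : f.totalDegree = δ)
    (hreg : RingTheory.Sequence.IsRegular (MvPolynomial (Fin n) F)
      (List.ofFn fun j : Fin n =>
        MvPolynomial.pderiv j (MvPolynomial.homogeneousComponent δ f))) :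
    (∀ i : ℕ, i ≠ n → ∀ ω : FormAlgebra F n, IsForm i ω → dform f * ω = 0 →
      ∃ η : FormAlgebra F n, IsForm (i - 1) η ∧ ω = dform f * η) ∧
    (FiniteDimensional F (MvPolynomial (Fin n) F ⧸
        Ideal.span (Set.range fun j => MvPolynomial.pderiv j f)) ∧
      Module.finrank F (MvPolynomial (Fin n) F ⧸
        Ideal.span (Set.range fun j => MvPolynomial.pderiv j f)) = (δ - 1) ^ n) ∧
    (FiniteDimensional F (topCohomology F n f) ∧
      Module.finrank F (topCohomology F n f) = (δ - 1) ^ n) := by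
  have h := finrank_quotient_span_pderiv hdeg hreg.toIsWeaklyRegular
  have := h.1
  exact ⟨fun _ hi _ hω h0 => exists_isForm_eq_dform_mul hdeg hreg.toIsWeaklyRegular hi hω h0, h,
    Module.Finite.equiv (quotientEquivTopCohomology f),
    (quotientEquivTopCohomology f).finrank_eq ▸ h.2⟩
end
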